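/- arXiv:2409.20275 — 3 statements merged into one kernel-verified Lean document; each statement's English description precedes it below -/
import Mathlib

section
/- Let X be a real n×m matrix with n > m and let k = rank(X) with k < m. Then the following are equivalent: (i) for every set J of k column indices, the k×k minors det(X_{I,J}), as I ranges over all k-element row index sets, are either all nonnegative or all nonpositive; (ii) for every u ∈ R^m, V(Xu) ≤ k−1. -/
open Matrix Polynomial Filter

noncomputable def signChanges (l : List ℝ) : ℕ :=
  (l.zip l.tail).countP (fun p => decide (p.1 * p.2 < 0))

/-- Variation `V(u)`: number of sign changes after deleting zero entries, `-1` for the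
zero vector. -/
noncomputable def variation {m : ℕ} (u : Fin m → ℝ) : ℤ :=
  if ((List.ofFn u).filter fun x => decide (x ≠ 0)) = [] then -1
  else (signChanges ((List.ofFn u).filter fun x => decide (x ≠ 0)) : ℤ)

/-- Maximal variation `V_z(u)`: largest number of sign changes obtainable by replacing every
zero entry of `u` by an arbitrary nonzero real number. -/
noncomputable def maxVariation {m : ℕ} (u : Fin m → ℝ) : ℤ :=
  sSup {v : ℤ | ∃ w : Fin m → ℝ, (∀ i, w i ≠ 0) ∧ (∀ i, u i ≠ 0 → w i = u i) ∧
    v = (signChanges (List.ofFn w) : ℤ)}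

/-- `X` is strictly `k`-variation bounding. -/
def SVB {n m : ℕ} (X : Matrix (Fin n) (Fin m) ℝ) (k : ℕ) : Prop :=
  ∀ u : Fin m → ℝ, u ≠ 0 → variation u ≤ (k : ℤ) → maxVariation (X.mulVec u) ≤ (k : ℤ)

/-- `X` is `k`-variation bounding. -/
def VB {n m : ℕ} (X : Matrix (Fin n) (Fin m) ℝ) (k : ℕ) : Prop :=
  ∀ u : Fin m → ℝ, u ≠ 0 → variation u ≤ (k : ℤ) → variation (X.mulVec u) ≤ (k : ℤ)

/-- `X` is `k`-variation diminishing. -/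
def VD {n m : ℕ} (X : Matrix (Fin n) (Fin m) ℝ) (k : ℕ) : Prop :=
  ∀ j : ℕ, j ≤ k → VB X j

/-- `X` is strictly `k`-sign consistent: all `k×k` minors strictly positive, or all strictly
negative. -/
def SSC {n m : ℕ} (X : Matrix (Fin n) (Fin m) ℝ) (k : ℕ) : Prop :=
  (∀ (f : Fin k → Fin n) (g : Fin k → Fin m), StrictMono f → StrictMono g →
    0 < (X.submatrix f g).det) ∨
  (∀ (f : Fin k → Fin n) (g : Fin k → Fin m), StrictMono f → StrictMono g →
    (X.submatrix f g).det < 0)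

/-- `X` is `k`-sign consistent: all `k×k` minors nonnegative, or all nonpositive. -/
def SC {n m : ℕ} (X : Matrix (Fin n) (Fin m) ℝ) (k : ℕ) : Prop :=
  (∀ (f : Fin k → Fin n) (g : Fin k → Fin m), StrictMono f → StrictMono g →
    0 ≤ (X.submatrix f g).det) ∨
  (∀ (f : Fin k → Fin n) (g : Fin k → Fin m), StrictMono f → StrictMono g →
    (X.submatrix f g).det ≤ 0)

/-- `X` is `k`-sign regular. -/
def SR {n m : ℕ} (X : Matrix (Fin n) (Fin m) ℝ) (k : ℕ) : Prop :=
  ∀ j : ℕ, 1 ≤ j → j ≤ k → SC X j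

/-- `X` is strictly totally positive. -/
def STP {n m : ℕ} (X : Matrix (Fin n) (Fin m) ℝ) : Prop :=
  ∀ (j : ℕ) (f : Fin j → Fin n) (g : Fin j → Fin m), StrictMono f → StrictMono g →
    0 < (X.submatrix f g).det

/-- `X` is `k`-positive: all `j×j` minors nonnegative for `j = 1, …, k`. -/
def KPos {n m : ℕ} (X : Matrix (Fin n) (Fin m) ℝ) (k : ℕ) : Prop :=
  ∀ j : ℕ, 1 ≤ j → j ≤ k → ∀ (f : Fin j → Fin n) (g : Fin j → Fin m),
    StrictMono f → StrictMono g → 0 ≤ (X.submatrix f g).det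

/-- `X` is strictly `k`-positive: all `j×j` minors positive for `j = 1, …, k`. -/
def KPosStrict {n m : ℕ} (X : Matrix (Fin n) (Fin m) ℝ) (k : ℕ) : Prop :=
  ∀ j : ℕ, 1 ≤ j → j ≤ k → ∀ (f : Fin j → Fin n) (g : Fin j → Fin m),
    StrictMono f → StrictMono g → 0 < (X.submatrix f g).det

/-- The `t`-step observability matrix `O_t` with `i`-th row `c Aⁱ⁻¹`. -/
noncomputable def obsMat {n : ℕ} (A : Matrix (Fin n) (Fin n) ℝ) (c : Fin n → ℝ) (t : ℕ) :
    Matrix (Fin t) (Fin n) ℝ :=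
  Matrix.of fun i j => Matrix.vecMul c (A ^ (i : ℕ)) j

/-- The pair `(A, c)` is observable. -/
def Observable {n : ℕ} (A : Matrix (Fin n) (Fin n) ℝ) (c : Fin n → ℝ) : Prop :=
  (obsMat A c n).det ≠ 0

/-- The observability operator of `(A, c)` is strictly `k`-variation bounding. -/
def ObsSVB {n : ℕ} (A : Matrix (Fin n) (Fin n) ℝ) (c : Fin n → ℝ) (k : ℕ) : Prop :=
  ∀ t : ℕ, 0 < t → SVB (obsMat A c t) k

/-- The observability operator of `(A, c)` is `k`-variation bounding. -/
def ObsVB {n : ℕ} (A : Matrix (Fin n) (Fin n) ℝ) (c : Fin n → ℝ) (k : ℕ) : Prop :=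
  ∀ t : ℕ, 0 < t → VB (obsMat A c t) k

/-- The matrix `M_r[t]`: first `n - r` rows `c, cA, …, cA^{n-r-1}`, last `r` rows
`cA^{n-r+t-1}, …, cA^{n+t-2}`. -/
noncomputable def Mrt {n : ℕ} (A : Matrix (Fin n) (Fin n) ℝ) (c : Fin n → ℝ) (r t : ℕ) :
    Matrix (Fin n) (Fin n) ℝ :=
  Matrix.of fun i j =>
    Matrix.vecMul c (A ^ (if (i : ℕ) < n - r then (i : ℕ) else (i : ℕ) + t - 1)) j

section Variation

theorem signChanges_cons_cons (x y : ℝ) (l : List ℝ) :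
    signChanges (x :: y :: l) = signChanges (y :: l) + if x * y < 0 then 1 else 0 := by
  simp [signChanges, List.countP_cons]

theorem signChanges_le_cons (x : ℝ) (l : List ℝ) : signChanges l ≤ signChanges (x :: l) := by
  cases l with
  | nil => simp [signChanges]
  | cons y l => rw [signChanges_cons_cons]; omega

theorem signChanges_cons_le_cons_cons {x y : ℝ} (hy : y ≠ 0) (l : List ℝ) :
    signChanges (x :: l) ≤ signChanges (x :: y :: l) := by
  cases l with
  | nil => simp [signChanges]
  | cons z l =>
    simp only [signChanges_cons_cons]
    by_cases hxz : x * z < 0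
    · by_cases hxy : x * y < 0
      · simp [hxz, hxy]
      · have hyz : y * z < 0 := by
          rcases lt_or_gt_of_ne hy with h | h <;>
          rcases mul_neg_iff.1 hxz with ⟨h1, h2⟩ | ⟨h1, h2⟩ <;> first
            | exact absurd (by nlinarith) hxy
            | nlinarith
        simp [hxz, hyz]
    · simp only [hxz, if_false]; omega

theorem length_le_signChanges_of_isChain_cons {l l' : List ℝ} {x : ℝ} (hl : ∀ y ∈ l, y ≠ 0)
    (hs : l'.Sublist l) (hc : (x :: l').IsChain fun a b => a * b < 0) :
    l'.length ≤ signChanges (x :: l) := by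
  induction l generalizing x l' with
  | nil => simp [List.sublist_nil.1 hs]
  | cons y l ih =>
    have hl' : ∀ z ∈ l, z ≠ 0 := fun z hz => hl z (List.mem_cons_of_mem _ hz)
    cases hs with
    | cons _ hs =>
      exact (ih hl' hs hc).trans (signChanges_cons_le_cons_cons (hl y List.mem_cons_self) l)
    | cons_cons _ hs =>
      rw [List.isChain_cons_cons] at hc
      rw [signChanges_cons_cons, if_pos hc.1, List.length_cons]
      exact Nat.succ_le_succ (ih hl' hs hc.2)

theorem length_le_signChanges_add_one_of_isChain {l l' : List ℝ} (hl : ∀ y ∈ l, y ≠ 0)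
    (hs : l'.Sublist l) (hc : l'.IsChain fun a b => a * b < 0) :
    l'.length ≤ signChanges l + 1 := by
  induction l with
  | nil => simp [List.sublist_nil.1 hs]
  | cons y l ih =>
    have hl' : ∀ z ∈ l, z ≠ 0 := fun z hz => hl z (List.mem_cons_of_mem _ hz)
    cases hs with
    | cons _ hs =>
      exact (ih hl' hs).trans (Nat.succ_le_succ (signChanges_le_cons y l))
    | cons_cons _ hs =>
      exact Nat.succ_le_succ (length_le_signChanges_of_isChain_cons hl' hs hc)

theorem exists_sublist_isChain_cons {l : List ℝ} {x : ℝ} (hx : x ≠ 0) (hl : ∀ y ∈ l, y ≠ 0) :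
    ∃ l' : List ℝ, l'.Sublist l ∧ ((x :: l').IsChain fun a b => a * b < 0) ∧
      l'.length = signChanges (x :: l) := by
  induction l generalizing x with
  | nil => exact ⟨[], by simp, by simp, by simp [signChanges]⟩
  | cons y l ih =>
    have hy : y ≠ 0 := hl y List.mem_cons_self
    obtain ⟨l', hs, hc, hlen⟩ := ih hy fun z hz => hl z (List.mem_cons_of_mem _ hz)
    by_cases hxy : x * y < 0
    · exact ⟨y :: l', hs.cons_cons y, List.isChain_cons_cons.2 ⟨hxy, hc⟩, by
        simp [signChanges_cons_cons, hxy, hlen]⟩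
    · refine ⟨l', hs.cons y, ?_, by simp [signChanges_cons_cons, hxy, hlen]⟩
      cases l' with
      | nil => simp
      | cons z l' =>
        rw [List.isChain_cons_cons] at hc ⊢
        refine ⟨?_, hc.2⟩
        have hxy' : 0 < x * y := lt_of_le_of_ne (not_lt.1 hxy) (mul_ne_zero hx hy).symm
        rcases pos_and_pos_or_neg_and_neg_of_mul_pos hxy' with ⟨h1, h2⟩ | ⟨h1, h2⟩ <;>
          nlinarith [hc.1]

/-- An alternating subfamily of `w` of length `k + 1` forces at least `k` sign changes. -/
theorem le_variation_of_alternating {n k : ℕ} {w : Fin n → ℝ} {e : Fin (k + 1) → Fin n}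
    (he : StrictMono e) (hw : ∀ j : Fin (k + 1), 0 < (-1 : ℝ) ^ (j : ℕ) * w (e j)) :
    (k : ℤ) ≤ variation w := by
  have hne : ∀ j, w (e j) ≠ 0 := fun j h => by simpa [h] using hw j
  set L := (List.ofFn w).filter fun x => decide (x ≠ 0) with hL
  have hsub : (List.ofFn (w ∘ e)).Sublist (List.ofFn w) := by
    rw [List.sublist_iff_exists_fin_orderEmbedding_get_eq]
    refine ⟨OrderEmbedding.ofStrictMono
      (fun i => Fin.cast (List.length_ofFn (f := w)).symm
        (e (Fin.cast (List.length_ofFn (f := w ∘ e)) i))) fun i j hij => he hij, fun i => ?_⟩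
    simp only [List.get_eq_getElem, List.getElem_ofFn]
    rfl
  have hsub' : (List.ofFn (w ∘ e)).Sublist L := by
    have h := hsub.filter fun x => decide (x ≠ 0)
    rwa [List.filter_eq_self.2] at h
    intro x hx
    obtain ⟨j, rfl⟩ := (List.mem_ofFn' _ _).1 hx
    simpa using hne j
  have hchain : (List.ofFn (w ∘ e)).IsChain fun a b => a * b < 0 := by
    rw [List.isChain_iff_getElem]
    intro i hi
    have hi' : i + 1 < k + 1 := by simpa using hi
    have h1 := hw ⟨i, by omega⟩
    have h2 := hw ⟨i + 1, hi'⟩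
    simp only [List.getElem_ofFn, Function.comp_apply]
    simp only [pow_succ] at h2
    rcases neg_one_pow_eq_or ℝ i with h | h <;> rw [h] at h1 h2 <;> nlinarith
  have hlen := length_le_signChanges_add_one_of_isChain (l := L) (by simp [hL]) hsub' hchain
  have hL0 : L ≠ [] := by
    intro h
    rw [h] at hsub'
    simpa using congrArg List.length (List.sublist_nil.1 hsub')
  rw [variation, if_neg hL0]
  simp only [List.length_ofFn] at hlen
  exact_mod_cast Nat.le_of_succ_le_succ hlen

/-- A vector with at least `k` sign changes has, up to a global sign, an alternating subfamily of
length `k + 1`. -/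
theorem exists_alternating_of_le_variation {n k : ℕ} {w : Fin n → ℝ}
    (h : (k : ℤ) ≤ variation w) :
    ∃ (c : ℝ) (e : Fin (k + 1) → Fin n), StrictMono e ∧
      ∀ j : Fin (k + 1), 0 < (-1 : ℝ) ^ (j : ℕ) * (c * w (e j)) := by
  rw [variation] at h
  split_ifs at h with h0
  · omega
  obtain ⟨x, l, hxl⟩ := List.exists_cons_of_ne_nil h0
  have hnz : ∀ y ∈ x :: l, y ≠ 0 := by
    rw [← hxl]; simp
  obtain ⟨l', hs, hc, hlen⟩ := exists_sublist_isChain_cons (hnz x List.mem_cons_self)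
    fun y hy => hnz y (List.mem_cons_of_mem _ hy)
  have hsub : (x :: l').Sublist (List.ofFn w) :=
    (hs.cons_cons x).trans (hxl ▸ List.filter_sublist)
  have hk : k + 1 ≤ (x :: l').length := by
    rw [hxl] at h
    rw [List.length_cons, hlen]
    exact_mod_cast Nat.succ_le_succ (by exact_mod_cast h)
  obtain ⟨φ, hφ⟩ := List.sublist_iff_exists_fin_orderEmbedding_get_eq.1 hsub
  have hval : ∀ j : Fin (k + 1),
      w (Fin.cast (List.length_ofFn (f := w)) (φ (Fin.castLE hk j))) =
        (x :: l')[(j : ℕ)]'(lt_of_lt_of_le j.2 hk) := by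
    intro j
    have := hφ (Fin.castLE hk j)
    simp only [List.get_eq_getElem, List.getElem_ofFn, Fin.val_castLE] at this
    rw [this]; rfl
  refine ⟨x, fun j => Fin.cast (List.length_ofFn (f := w)) (φ (Fin.castLE hk j)),
    fun i j hij => φ.strictMono (Fin.strictMono_castLE hk hij), ?_⟩
  rintro ⟨j, hj⟩
  rw [hval]
  simp only
  have hx : 0 < x * x := mul_self_pos.2 (hnz x List.mem_cons_self)
  induction j with
  | zero => simpa using hx
  | succ j ih =>
    have h1 := ih (by omega)
    have h2 := List.isChain_iff_getElem.1 hc j (by omega)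
    set a := (x :: l')[j]'(by omega)
    set b := (x :: l')[j + 1]'(by omega)
    have h3 : 0 < (-1 : ℝ) ^ (j + 1) * (x * b) * (a * a) := by
      have : (-1 : ℝ) ^ (j + 1) * (x * b) * (a * a) =
        ((-1 : ℝ) ^ j * (x * a)) * (-(a * b)) := by ring
      rw [this]
      exact mul_pos h1 (by linarith)
    exact pos_of_mul_pos_left h3 (mul_self_nonneg a)

end Variation

section AlternatingForm

open Module

variable {E : Type*} [AddCommGroup E] [Module ℝ E]

/-- In dimension `k`, a linear functional wedged with a `k`-form vanishes. -/
theorem sum_neg_one_pow_mul_alternatingMap_eq_zero [FiniteDimensional ℝ E] {k : ℕ}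
    (hE : finrank ℝ E = k) (ω : E [⋀^Fin k]→ₗ[ℝ] ℝ) (φ : E →ₗ[ℝ] ℝ) (v : Fin (k + 1) → E) :
    ∑ j : Fin (k + 1), (-1 : ℝ) ^ (j : ℕ) * φ (v j) * ω (v ∘ j.succAbove) = 0 := by
  let b : Basis (Fin k) ℝ E := finBasisOfFinrankEq ℝ E hE
  let M : Matrix (Fin (k + 1)) (Fin (k + 1)) ℝ :=
    Matrix.of fun j => Fin.cons (φ (v j)) fun l => b.repr (v j) l
  have hM : M.det = 0 := by
    rw [← Matrix.exists_mulVec_eq_zero_iff]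
    refine ⟨Fin.cons (-1) fun l => φ (b l), fun h => ?_, ?_⟩
    · simpa using congrFun h 0
    · ext j
      have hj : φ (v j) = ∑ l, b.repr (v j) l * φ (b l) := by
        conv_lhs => rw [← b.sum_repr (v j)]
        simp only [map_sum, map_smul, smul_eq_mul]
      simp [M, Matrix.mulVec, dotProduct, Fin.sum_univ_succ, hj]
  rw [Matrix.det_succ_column_zero] at hM
  have hω : ∀ j : Fin (k + 1), ω (v ∘ j.succAbove) =
      ω b * (M.submatrix j.succAbove Fin.succ).det := by
    intro j
    conv_lhs => rw [ω.eq_smul_basis_det b]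
    rw [AlternatingMap.smul_apply, smul_eq_mul, Basis.det_apply, ← Matrix.det_transpose]
    congr 2
  calc _ = ω b * ∑ j : Fin (k + 1), (-1 : ℝ) ^ (j : ℕ) * M j 0 *
        (M.submatrix j.succAbove Fin.succ).det := by
        rw [Finset.mul_sum]
        refine Finset.sum_congr rfl fun j _ => ?_
        rw [hω]
        simp only [M, Matrix.of_apply, Fin.cons_zero]
        ring
    _ = 0 := by rw [hM, mul_zero]

theorem linearIndependent_of_alternatingMap_ne_zero {k : ℕ} (ω : E [⋀^Fin k]→ₗ[ℝ] ℝ)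
    {v : Fin k → E} (h : ω v ≠ 0) : LinearIndependent ℝ v := by
  by_contra hv
  exact h (ω.map_linearDependent v hv)

theorem alternatingMap_ne_zero_of_linearIndependent [FiniteDimensional ℝ E] {k : ℕ}
    (hE : finrank ℝ E = k) {ω : E [⋀^Fin k]→ₗ[ℝ] ℝ} (hω : ω ≠ 0) {v : Fin k → E}
    (hv : LinearIndependent ℝ v) : ω v ≠ 0 := by
  have := ω.map_basis_ne_zero_iff
    (Basis.mk hv (hv.span_eq_top_of_card_eq_finrank' (by simp [hE])).ge)
  rw [Basis.coe_mk] at this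
  exact this.2 hω

/-- Sorting the indices of a family on which an alternating form does not vanish. -/
theorem exists_strictMono_comp_of_injective {k n : ℕ} {h : Fin k → Fin n}
    (hinj : Function.Injective h) (ω : E [⋀^Fin k]→ₗ[ℝ] ℝ) {a : Fin n → E} (hω : ω (a ∘ h) ≠ 0) :
    ∃ f : Fin k → Fin n, StrictMono f ∧ Set.range f = Set.range h ∧ ω (a ∘ f) ≠ 0 := by
  refine ⟨h ∘ Tuple.sort h, (Tuple.monotone_sort h).strictMono_of_injective
    (hinj.comp (Tuple.sort h).injective), (Tuple.sort h).surjective.range_comp h, ?_⟩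
  rw [← Function.comp_assoc, ω.map_perm]
  rcases Int.units_eq_one_or (Equiv.Perm.sign (Tuple.sort h)) with h1 | h1 <;> simp [h1, hω]

/-- A spanning family in dimension `k` contains a `k`-element subfamily on which a given nonzero
`k`-form does not vanish. -/
theorem exists_strictMono_alternatingMap_ne_zero [FiniteDimensional ℝ E] {k n : ℕ}
    (hE : finrank ℝ E = k) {ω : E [⋀^Fin k]→ₗ[ℝ] ℝ} (hω : ω ≠ 0) {a : Fin n → E}
    (ha : Submodule.span ℝ (Set.range a) = ⊤) :
    ∃ f : Fin k → Fin n, StrictMono f ∧ ω (a ∘ f) ≠ 0 := by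
  obtain ⟨v, hv, -, hli⟩ := Submodule.exists_fun_fin_finrank_span_eq ℝ (Set.range a)
  have hk : finrank ℝ (Submodule.span ℝ (Set.range a)) = k := by rw [ha, finrank_top, hE]
  choose h hh using hv
  have hli' : LinearIndependent ℝ (a ∘ h ∘ Fin.cast hk.symm) := by
    have : a ∘ h ∘ Fin.cast hk.symm = v ∘ Fin.cast hk.symm := by
      ext1 i; exact hh _
    rw [this]
    exact hli.comp _ (Fin.cast_injective _)
  obtain ⟨f, hf, -, hne⟩ := exists_strictMono_comp_of_injective
    hli'.injective.of_comp ω (alternatingMap_ne_zero_of_linearIndependent hE hω hli')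
  exact ⟨f, hf, hne⟩

theorem span_eq_top_of_alternatingMap_ne_zero [FiniteDimensional ℝ E] {k n : ℕ}
    (hE : finrank ℝ E = k) (ω : E [⋀^Fin k]→ₗ[ℝ] ℝ) {a : Fin n → E} {f : Fin k → Fin n}
    (h : ω (a ∘ f) ≠ 0) : Submodule.span ℝ (Set.range a) = ⊤ := by
  rw [eq_top_iff, ← (linearIndependent_of_alternatingMap_ne_zero ω
    h).span_eq_top_of_card_eq_finrank' (by simp [hE])]
  exact Submodule.span_mono (Set.range_comp_subset_range f a)

theorem exists_split_of_strictMono {k n : ℕ} {e : Fin (k + 1) → Fin n} (he : StrictMono e)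
    {t : Fin n} (ht : ∀ j, e j ≠ t) :
    ∃ p : Fin (k + 1), (∀ j < p, e j < t) ∧ ∀ j, p < j → t < e j := by
  by_cases h : ∃ j, t < e j
  · obtain ⟨p, hp, hmin⟩ := WellFounded.has_min (wellFounded_lt (α := Fin (k + 1)))
      {j | t < e j} h
    exact ⟨p, fun j hj => lt_of_le_of_ne (not_lt.1 fun h' => hmin j h' hj) (ht j),
      fun j hj => lt_trans hp (he hj)⟩
  · push Not at h
    exact ⟨Fin.last k, fun j _ => lt_of_le_of_ne (h j) (ht j),
      fun j hj => absurd hj (not_lt.2 (Fin.le_last j))⟩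

/-- Shear invariance: subtracting multiples of the first argument from the others does not change
the value of an alternating map. -/
theorem alternatingMap_vecCons_sub_smul {k : ℕ} (ω : E [⋀^Fin (k + 1)]→ₗ[ℝ] ℝ) (x : E)
    (v : Fin k → E) (c : Fin k → ℝ) :
    ω (Matrix.vecCons x fun i => v i - c i • x) = ω (Matrix.vecCons x v) := by
  have key : ∀ s : Finset (Fin k),
      ω.curryLeft x (s.piecewise (fun i => v i - c i • x) v) = ω.curryLeft x v := by
    intro s
    induction s using Finset.induction_on with
    | empty => simp
    | insert i s hi ih =>
      rw [Finset.piecewise_insert, AlternatingMap.map_update_sub, AlternatingMap.map_update_smul]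
      have h0 : ω.curryLeft x
          (Function.update (s.piecewise (fun i => v i - c i • x) v) i x) = 0 := by
        rw [AlternatingMap.curryLeft_apply_apply]
        exact ω.map_eq_zero_of_eq (i := 0) (j := i.succ) _ (by simp) (Fin.succ_ne_zero i).symm
      have h1 : Function.update (s.piecewise (fun i => v i - c i • x) v) i (v i) =
          s.piecewise (fun i => v i - c i • x) v := by
        rw [Function.update_eq_self_iff]
        simp [hi]
      rw [h0, h1, ih, smul_zero, sub_zero]
  simpa using key Finset.univ

/-- The value of a form on a sorted family with an additional vector put in front,
corrected by the sign needed to move that vector to its place. -/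
theorem prod_sign_mul_alternatingMap_cons_nonneg {k n : ℕ} {ω : E [⋀^Fin (k + 1)]→ₗ[ℝ] ℝ}
    {a : Fin n → E} (hpos : ∀ f : Fin (k + 1) → Fin n, StrictMono f → 0 ≤ ω (a ∘ f))
    (t : Fin n) {f : Fin k → Fin n} (hf : StrictMono f) :
    0 ≤ (∏ i, if f i < t then (-1 : ℝ) else 1) * ω (Matrix.vecCons (a t) (a ∘ f)) := by
  by_cases ht : ∃ i, f i = t
  · obtain ⟨i, hi⟩ := ht
    rw [ω.map_eq_zero_of_eq (i := 0) (j := i.succ) _ (by simp [hi]) (Fin.succ_ne_zero i).symm,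
      mul_zero]
  · push Not at ht
    have hcard : (Finset.univ.filter fun i => f i < t).card < k + 1 :=
      Nat.lt_succ_of_le ((Finset.card_filter_le _ _).trans (by simp))
    set p : Fin (k + 1) := ⟨(Finset.univ.filter fun i => f i < t).card, hcard⟩ with hp
    have hlt : ∀ i : Fin k, i.castSucc < p ↔ f i < t := fun i =>
      Tuple.lt_card_lt_iff_apply_lt_of_monotone hf.monotone
    have hmono : StrictMono (p.insertNth t f : Fin (k + 1) → Fin n) := by
      rw [Fin.strictMono_insertNth_iff]
      refine ⟨hf, fun i hi => (hlt i).1 hi, fun i hi => ?_⟩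
      exact lt_of_le_of_ne (not_lt.1 fun h => not_lt.2 hi ((hlt i).2 h)) (ht i).symm
    have hprod : (∏ i, if f i < t then (-1 : ℝ) else 1) = (-1) ^ (p : ℕ) := by
      rw [Finset.prod_ite]
      simp [hp]
    have h := hpos _ hmono
    have hins : a ∘ (p.insertNth t f : Fin (k + 1) → Fin n) = p.insertNth (a t) (a ∘ f) := by
      ext1 i
      cases i using p.succAboveCases <;> simp
    rw [hins, ω.map_insertNth] at h
    rw [hprod]
    simpa using h

/-- If all `ω (a ∘ f)` with `f` increasing are nonnegative and not all zero, then no linear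
functional alternates in sign along a `k + 1`-element subfamily of `a`. -/
theorem not_alternating_of_nonneg {k n : ℕ} [FiniteDimensional ℝ E] (hE : finrank ℝ E = k)
    (ω : E [⋀^Fin k]→ₗ[ℝ] ℝ) (a : Fin n → E)
    (hpos : ∀ f : Fin k → Fin n, StrictMono f → 0 ≤ ω (a ∘ f))
    (hne : ∃ f : Fin k → Fin n, StrictMono f ∧ ω (a ∘ f) ≠ 0)
    (φ : E →ₗ[ℝ] ℝ) {e : Fin (k + 1) → Fin n} (he : StrictMono e) :
    ¬ ∀ j : Fin (k + 1), 0 < (-1 : ℝ) ^ (j : ℕ) * φ (a (e j)) := by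
  intro hφ
  induction k generalizing E with
  | zero =>
    have := finrank_zero_iff.1 hE
    have h := hφ 0
    rw [Subsingleton.elim (a (e 0)) 0] at h
    simp at h
  | succ k ih =>
    have hsum := sum_neg_one_pow_mul_alternatingMap_eq_zero hE ω φ (a ∘ e)
    have hzero : ∀ j : Fin (k + 1 + 1), ω ((a ∘ e) ∘ j.succAbove) = 0 := by
      intro j
      have hnn : ∀ j ∈ (Finset.univ : Finset (Fin (k + 1 + 1))), 0 ≤ (-1 : ℝ) ^ (j : ℕ) * φ ((a ∘ e) j) *
          ω ((a ∘ e) ∘ j.succAbove) := fun j _ =>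
        mul_nonneg (hφ j).le (hpos _ (he.comp (Fin.strictMono_succAbove j)))
      have := (Finset.sum_eq_zero_iff_of_nonneg hnn).1 hsum j (Finset.mem_univ j)
      exact (mul_eq_zero.1 this).resolve_left (hφ j).ne'
    obtain ⟨f₀, hf₀, hf₀ne⟩ := hne
    have hω0 : ω ≠ 0 := fun h => hf₀ne (by rw [h]; rfl)
    have hspan : Submodule.span ℝ (Set.range (a ∘ e)) ≠ ⊤ := by
      intro htop
      obtain ⟨h, hh, hhne⟩ := exists_strictMono_alternatingMap_ne_zero hE hω0 htop
      obtain ⟨j, hj⟩ : ∃ j, j ∉ Set.range h := by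
        by_contra! hsurj
        have := Fintype.card_le_of_surjective h hsurj
        simp at this
      have hrange : h = j.succAbove := by
        refine (StrictMono.range_inj hh (Fin.strictMono_succAbove j)).1 ?_
        rw [Fin.range_succAbove]
        refine Set.eq_of_subset_of_ncard_le (fun x hx hxj => hj (hxj ▸ hx)) ?_
          (Set.toFinite _)
        rw [Set.ncard_compl, Set.ncard_singleton, ← Set.image_univ,
          Set.ncard_image_of_injective _ hh.injective]
        simp
      exact hhne (hrange ▸ hzero j)
    obtain ⟨t, ht⟩ : ∃ t, a t ∉ Submodule.span ℝ (Set.range (a ∘ e)) := by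
      by_contra! hall
      apply hspan
      rw [eq_top_iff, ← span_eq_top_of_alternatingMap_ne_zero hE ω hf₀ne, Submodule.span_le]
      rintro _ ⟨t, rfl⟩
      exact hall t
    obtain ⟨ψ, hψt, hψe⟩ : ∃ ψ : E →ₗ[ℝ] ℝ, ψ (a t) = 1 ∧ ∀ j, ψ (a (e j)) = 0 := by
      obtain ⟨ψ, hψ, hker⟩ := Submodule.exists_le_ker_of_notMem ht
      refine ⟨(ψ (a t))⁻¹ • ψ, by simp [hψ], fun j => ?_⟩
      have : ψ (a (e j)) = 0 := hker (Submodule.subset_span ⟨j, rfl⟩)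
      simp [this]
    have hte : ∀ j, e j ≠ t := fun j h => by
      have := hψe j
      rw [h, hψt] at this
      exact one_ne_zero this
    have hE' : finrank ℝ (LinearMap.ker ψ) = k := by
      have h1 := LinearMap.finrank_range_add_finrank_ker ψ
      rw [LinearMap.range_eq_top.2 (LinearMap.surjective fun h => by simp [h] at hψt),
        finrank_top, finrank_self, hE] at h1
      omega
    let σ : Fin n → ℝ := fun i => if i < t then -1 else 1
    have hσ : ∀ i, σ i ≠ 0 := fun i => by
      simp only [σ]; split_ifs <;> norm_num
    let a' : Fin n → LinearMap.ker ψ := fun i =>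
      ⟨σ i • (a i - ψ (a i) • a t), by simp [hψt]⟩
    let ω' : LinearMap.ker ψ [⋀^Fin k]→ₗ[ℝ] ℝ :=
      (ω.curryLeft (a t)).compLinearMap (LinearMap.ker ψ).subtype
    have hω' : ∀ f : Fin k → Fin n,
        ω' (a' ∘ f) = (∏ i, σ (f i)) * ω (Matrix.vecCons (a t) (a ∘ f)) := by
      intro f
      have h1 : ω' (a' ∘ f) =
          ω.curryLeft (a t) fun i => σ (f i) • (a (f i) - ψ (a (f i)) • a t) := rfl
      rw [h1, AlternatingMap.map_smul_univ, smul_eq_mul]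
      congr 1
      exact alternatingMap_vecCons_sub_smul ω (a t) (a ∘ f) fun i => ψ (a (f i))
    obtain ⟨p, hplt, hpgt⟩ := exists_split_of_strictMono he hte
    refine ih (E := LinearMap.ker ψ) hE' ω' a' (fun f hf => ?_) ?_
      (-(φ.comp (LinearMap.ker ψ).subtype))
      (e := e ∘ p.succAbove) (he.comp (Fin.strictMono_succAbove p)) (fun j => ?_)
    · rw [hω']
      exact prod_sign_mul_alternatingMap_cons_nonneg hpos t hf
    · have hsum' := sum_neg_one_pow_mul_alternatingMap_eq_zero hE ω ψ
        (Matrix.vecCons (a t) (a ∘ f₀))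
      by_contra! hall
      rw [Fin.sum_univ_succ, Finset.sum_eq_zero, add_zero] at hsum'
      · apply hf₀ne
        simpa [hψt, Function.comp_def] using hsum'
      · intro i _
        have h1 := hall (f₀ ∘ i.succAbove) (hf₀.comp (Fin.strictMono_succAbove i))
        rw [hω'] at h1
        have h2 := (mul_eq_zero.1 h1).resolve_left (Finset.prod_ne_zero_iff.2 fun _ _ => hσ _)
        have h3 : (Matrix.vecCons (a t) (a ∘ f₀)) ∘ i.succ.succAbove =
            Matrix.vecCons (a t) (a ∘ f₀ ∘ i.succAbove) := by
          ext1 l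
          cases l using Fin.cases <;> simp
        rw [h3, h2, mul_zero]
    · have hval : (-(φ.comp (LinearMap.ker ψ).subtype)) (a' ((e ∘ p.succAbove) j)) =
          -(σ (e (p.succAbove j)) * φ (a (e (p.succAbove j)))) := by
        simp [a', hψe]
      rw [hval]
      have h := hφ (p.succAbove j)
      rcases lt_or_ge j.castSucc p with hj | hj
      · have hlt := hplt _ hj
        rw [Fin.succAbove_of_castSucc_lt _ _ hj] at h ⊢
        simpa [σ, hlt] using h
      · have hgt := hpgt j.succ (Fin.le_castSucc_iff.1 hj)
        rw [Fin.succAbove_of_le_castSucc _ _ hj] at h ⊢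
        simpa [σ, hgt.not_gt, pow_succ] using h

/-- If two `k`-subfamilies of a `k + 1`-element family have opposite signs under `ω`, some linear
functional alternates in sign along that family. -/
theorem exists_alternating_of_mul_neg {k : ℕ} [FiniteDimensional ℝ E] (hE : finrank ℝ E = k)
    (ω : E [⋀^Fin k]→ₗ[ℝ] ℝ) (v : Fin (k + 1) → E) {p q : Fin (k + 1)}
    (h : ω (v ∘ p.succAbove) * ω (v ∘ q.succAbove) < 0) :
    ∃ φ : E →ₗ[ℝ] ℝ, ∀ j : Fin (k + 1), 0 < (-1 : ℝ) ^ (j : ℕ) * φ (v j) := by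
  set m : Fin (k + 1) → ℝ := fun j => ω (v ∘ j.succAbove) with hm
  have hq : m q ≠ 0 := right_ne_zero_of_mul h.ne
  have hpq : p ≠ q := by
    rintro rfl
    exact absurd h (not_lt.2 (mul_self_nonneg _))
  obtain ⟨i₀, rfl⟩ := Fin.exists_succAbove_eq hpq
  obtain ⟨C, hC, hneg⟩ : ∃ C : ℝ, 0 < C ∧
      C * (m (q.succAbove i₀) * m q) + ∑ i, m (q.succAbove i) * m q < 0 := by
    refine ⟨(|∑ i, m (q.succAbove i) * m q| + 1) / (-(m (q.succAbove i₀) * m q)),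
      div_pos (by positivity) (by simpa using h), ?_⟩
    rw [div_mul_eq_mul_div, div_neg, mul_div_assoc, div_self h.ne]
    have := le_abs_self (∑ i, m (q.succAbove i) * m q)
    linarith
  let z : Fin k → ℝ := fun i => 1 + if i = i₀ then C else 0
  have hz : ∀ i, 0 < z i := fun i => by
    simp only [z]; split_ifs <;> linarith
  have hzsum : ∑ i, z i * (m (q.succAbove i) * m q) < 0 := by
    simp only [z, add_mul, one_mul, ite_mul, zero_mul, Finset.sum_add_distrib,
      Finset.sum_ite_eq', Finset.mem_univ, if_true]
    linarith
  have hli := linearIndependent_of_alternatingMap_ne_zero ω hq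
  let b : Basis (Fin k) ℝ E :=
    Basis.mk hli (hli.span_eq_top_of_card_eq_finrank' (by simp [hE])).ge
  let φ : E →ₗ[ℝ] ℝ := b.constr ℝ fun i => (-1) ^ (q.succAbove i : ℕ) * z i
  have hφ : ∀ i, φ (v (q.succAbove i)) = (-1) ^ (q.succAbove i : ℕ) * z i := fun i => by
    have : v (q.succAbove i) = b i := by simp [b]
    rw [this, Basis.constr_basis]
  have hsq : ∀ l : ℕ, (-1 : ℝ) ^ l * (-1) ^ l = 1 := fun l => by
    rw [← mul_pow]; simp
  have hφ' : ∀ i, (-1 : ℝ) ^ (q.succAbove i : ℕ) * φ (v (q.succAbove i)) = z i := fun i => by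
    rw [hφ, ← mul_assoc, hsq, one_mul]
  refine ⟨φ, fun j => ?_⟩
  cases j using q.succAboveCases with
  | p i => rw [hφ']; exact hz i
  | x =>
    have hsum := sum_neg_one_pow_mul_alternatingMap_eq_zero hE ω φ v
    rw [Fin.sum_univ_succAbove _ q] at hsum
    simp only [hφ'] at hsum
    have h1 : (-1 : ℝ) ^ (q : ℕ) * φ (v q) * (m q * m q) =
        -∑ i, z i * (m (q.succAbove i) * m q) := by
      have h2 : (∑ i, z i * (m (q.succAbove i) * m q)) =
          (∑ i, z i * m (q.succAbove i)) * m q := by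
        rw [Finset.sum_mul]
        exact Finset.sum_congr rfl fun i _ => by ring
      rw [h2]
      have h3 : (-1 : ℝ) ^ (q : ℕ) * φ (v q) * m q + ∑ i, z i * m (q.succAbove i) = 0 := hsum
      linear_combination m q * h3
    exact pos_of_mul_pos_left (by rw [h1]; linarith) (mul_self_nonneg (m q))

/-- If no linear functional alternates in sign along a `k + 1`-element subfamily of `a`,
then `ω (a ∘ f)`, for `f` increasing, does not take both signs. -/
theorem not_mul_neg_of_not_alternating {k n : ℕ} [FiniteDimensional ℝ E]
    (hE : finrank ℝ E = k) (ω : E [⋀^Fin k]→ₗ[ℝ] ℝ) (a : Fin n → E)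
    (halt : ∀ (φ : E →ₗ[ℝ] ℝ) (e : Fin (k + 1) → Fin n), StrictMono e →
      ¬ ∀ j : Fin (k + 1), 0 < (-1 : ℝ) ^ (j : ℕ) * φ (a (e j)))
    {f g : Fin k → Fin n} (hf : StrictMono f) (hg : StrictMono g) :
    ¬ ω (a ∘ f) * ω (a ∘ g) < 0 := by
  intro hneg
  induction hd : (Finset.univ.image f \ Finset.univ.image g).card using Nat.strong_induction_on
    generalizing f with
  | _ d ih =>
  have hfne : ω (a ∘ f) ≠ 0 := left_ne_zero_of_mul hneg.ne
  have hgne : ω (a ∘ g) ≠ 0 := right_ne_zero_of_mul hneg.ne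
  obtain ⟨i, hi⟩ : ∃ i, f i ∉ Set.range g := by
    by_contra! hall
    have hrange : f = g := by
      refine (StrictMono.range_inj hf hg).1 (Set.eq_of_subset_of_ncard_le
        (Set.range_subset_iff.2 hall) ?_ (Set.toFinite _))
      rw [← Set.image_univ, ← Set.image_univ, Set.ncard_image_of_injective _ hf.injective,
        Set.ncard_image_of_injective _ hg.injective]
    rw [hrange] at hneg
    exact absurd hneg (not_lt.2 (mul_self_nonneg _))
  obtain ⟨l, hl⟩ : ∃ l, ω (Function.update (a ∘ f) i (a (g l))) ≠ 0 := by
    by_contra! hall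
    have hsum := sum_neg_one_pow_mul_alternatingMap_eq_zero hE ω
      (ω.toMultilinearMap.toLinearMap (a ∘ f) i) (Matrix.vecCons (a (f i)) (a ∘ g))
    rw [Fin.sum_univ_succ, Finset.sum_eq_zero, add_zero] at hsum
    · have h0 : ω (Function.update (a ∘ f) i (a (f i))) ≠ 0 := by
        rwa [Function.update_eq_self_iff.2 (by simp)]
      have h1 : (Matrix.vecCons (a (f i)) (a ∘ g)) ∘ (0 : Fin (k + 1)).succAbove = a ∘ g := by
        ext1 x; simp
      rw [h1] at hsum
      simp [h0, hgne] at hsum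
    · intro l _
      simp [hall]
  have hgl : ∀ x, f x ≠ g l := by
    intro x hx
    by_cases hxi : x = i
    · exact hi ⟨l, by rw [← hx, hxi]⟩
    · exact hl (ω.map_eq_zero_of_eq _ (by simp [hxi, hx]) hxi)
  have hinj : Function.Injective (Function.update f i (g l)) := by
    intro x y hxy
    by_cases hx : x = i <;> by_cases hy : y = i
    · rw [hx, hy]
    · subst hx
      rw [Function.update_self, Function.update_of_ne hy] at hxy
      exact absurd hxy.symm (hgl y)
    · subst hy
      rw [Function.update_self, Function.update_of_ne hx] at hxy
      exact absurd hxy (hgl x)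
    · rw [Function.update_of_ne hx, Function.update_of_ne hy] at hxy
      exact hf.injective hxy
  obtain ⟨f', hf', hrange, hf'ne⟩ := exists_strictMono_comp_of_injective hinj ω (a := a)
    (by rwa [Function.comp_update])
  have hK : (insert (g l) (Finset.univ.image f)).card = k + 1 := by
    rw [Finset.card_insert_of_notMem (by simp [hgl]), Finset.card_image_of_injective _ hf.injective]
    simp
  set e := (insert (g l) (Finset.univ.image f)).orderEmbOfFin hK with he
  have hcover : ∀ (h : Fin k → Fin n) (x : Fin n), StrictMono h → x ∉ Set.range h →
      insert x (Set.range h) = Set.range e → ∃ p : Fin (k + 1), h = e ∘ p.succAbove := by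
    intro h x hh hx hins
    obtain ⟨p, hp⟩ : x ∈ Set.range e := hins ▸ Set.mem_insert _ _
    refine ⟨p, (StrictMono.range_inj hh (e.strictMono.comp (Fin.strictMono_succAbove p))).1 ?_⟩
    rw [Set.range_comp, Fin.range_succAbove, Set.image_compl_eq_range_sdiff_image e.injective,
      Set.image_singleton, ← hins, hp]
    simp [hx]
  have hrange_e : Set.range e = insert (g l) (Set.range f) := by
    rw [he, Finset.range_orderEmbOfFin]; simp
  have hmem : ∀ y, y ∈ Set.range f' ↔ y = g l ∨ y ∈ Set.range f ∧ y ≠ f i := by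
    intro y
    rw [hrange]
    constructor
    · rintro ⟨x, rfl⟩
      by_cases hx : x = i
      · subst hx
        simp
      · rw [Function.update_of_ne hx]
        exact Or.inr ⟨⟨x, rfl⟩, fun h => hx (hf.injective h)⟩
    · rintro (rfl | ⟨⟨x, rfl⟩, hx⟩)
      · exact ⟨i, by simp⟩
      · exact ⟨x, Function.update_of_ne (fun h => hx (by rw [h])) _ _⟩
  obtain ⟨p, hp⟩ := hcover f (g l) hf (by simpa using hgl) hrange_e.symm
  obtain ⟨q, hq⟩ := hcover f' (f i) hf' (by simp [hmem, hgl]) (by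
    rw [hrange_e]
    ext y
    rw [Set.mem_insert_iff, Set.mem_insert_iff, hmem]
    by_cases hy : y = f i
    · simp [hy]
    · simp [hy])
  rcases lt_or_gt_of_ne (mul_ne_zero hfne hf'ne) with hlt | hgt
  · rw [hp, hq] at hlt
    obtain ⟨φ, hφ⟩ := exists_alternating_of_mul_neg hE ω (a ∘ e) hlt
    exact halt φ e e.strictMono hφ
  · refine ih _ ?_ hf' ?_ rfl
    · rw [← hd]
      have himage : ∀ (h : Fin k → Fin n) (y : Fin n),
          y ∈ Finset.univ.image h ↔ y ∈ Set.range h := fun h y => by simp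
      refine Finset.card_lt_card ⟨fun y hy => ?_, fun hsub => ?_⟩
      · rw [Finset.mem_sdiff, himage, himage, hmem] at hy
        rw [Finset.mem_sdiff, himage, himage]
        rcases hy with ⟨rfl | ⟨hy, -⟩, hyg⟩
        · exact absurd ⟨l, rfl⟩ hyg
        · exact ⟨hy, hyg⟩
      · have hfi : f i ∈ Finset.univ.image f \ Finset.univ.image g := by
          rw [Finset.mem_sdiff, himage, himage]
          exact ⟨⟨i, rfl⟩, hi⟩
        have hfi' := hsub hfi
        rw [Finset.mem_sdiff, himage, himage, hmem] at hfi'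
        rcases hfi'.1 with h | h
        · exact hgl i h
        · exact h.2 rfl
    · have : ω (a ∘ f) * ω (a ∘ f') * (ω (a ∘ f') * ω (a ∘ g)) < 0 := by
        have : ω (a ∘ f) * ω (a ∘ f') * (ω (a ∘ f') * ω (a ∘ g)) =
          (ω (a ∘ f) * ω (a ∘ g)) * (ω (a ∘ f') * ω (a ∘ f')) := by ring
        rw [this]
        exact mul_neg_of_neg_of_pos hneg (mul_self_pos.2 hf'ne)
      exact lt_of_not_ge fun h => absurd this (not_lt.2 (mul_nonneg hgt.le h))

end AlternatingForm

/-- Some `k = rank X` columns of `X` determine all the vectors in its row space. -/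
theorem exists_strictMono_injOn_row_span {n m k : ℕ} {X : Matrix (Fin n) (Fin m) ℝ}
    (hX : X.rank = k) :
    ∃ g : Fin k → Fin m, StrictMono g ∧
      ∀ x ∈ Submodule.span ℝ (Set.range X.row), x ∘ g = 0 → x = 0 := by
  obtain ⟨v, hv, hspan, hli⟩ := Submodule.exists_fun_fin_finrank_span_eq ℝ (Set.range X.col)
  have hk : Module.finrank ℝ (Submodule.span ℝ (Set.range X.col)) = k := by
    rw [← hX, X.rank_eq_finrank_span_cols]
  choose h hh using hv
  let h' : Fin k → Fin m := h ∘ Fin.cast hk.symm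
  have hinj : Function.Injective h' := by
    refine Function.Injective.comp (fun i j hij => hli.injective ?_) (Fin.cast_injective _)
    rw [← hh, ← hh, hij]
  refine ⟨h' ∘ Tuple.sort h', (Tuple.monotone_sort h').strictMono_of_injective
    (hinj.comp (Tuple.sort h').injective), fun x hx hx0 => ?_⟩
  have hxh : ∀ i, x (h i) = 0 := fun i => by
    have := congrFun hx0 ((Tuple.sort h').symm (Fin.cast hk i))
    simpa [h'] using this
  ext j
  have hj : X.col j ∈ Submodule.span ℝ (Set.range v) := by
    rw [hspan]; exact Submodule.subset_span ⟨j, rfl⟩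
  obtain ⟨c, hc⟩ := (Submodule.mem_span_range_iff_exists_fun ℝ).1 hj
  have hrow : ∀ y ∈ Submodule.span ℝ (Set.range X.row), y j = ∑ i, c i * y (h i) := by
    intro y hy
    induction hy using Submodule.span_induction with
    | mem y hy =>
      obtain ⟨r, rfl⟩ := hy
      have := congrFun hc r
      simp only [Finset.sum_apply, Pi.smul_apply, smul_eq_mul, ← hh] at this
      exact this.symm
    | zero => simp
    | add y z _ _ hy hz => simp [hy, hz, mul_add, Finset.sum_add_distrib]
    | smul r y _ hy =>
      simp only [Pi.smul_apply, smul_eq_mul, hy, Finset.mul_sum]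
      exact Finset.sum_congr rfl fun i _ => by ring
  simp [hrow x hx, hxh]

/-- for `n > m`, `k = rank X < m`: every set of `k` columns yields `k`-minors of
one (weak) sign iff `V(Xu) ≤ k - 1` for every `u`. -/
theorem stmt4 {n m : ℕ} (X : Matrix (Fin n) (Fin m) ℝ) (k : ℕ)
    (hnm : m < n) (hrk : X.rank = k) (hkm : k < m) :
    (∀ g : Fin k → Fin m, StrictMono g →
        (∀ f : Fin k → Fin n, StrictMono f → 0 ≤ (X.submatrix f g).det) ∨
        (∀ f : Fin k → Fin n, StrictMono f → (X.submatrix f g).det ≤ 0)) ↔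
      (∀ u : Fin m → ℝ, variation (X.mulVec u) ≤ (k : ℤ) - 1) := by
  let E : Submodule ℝ (Fin m → ℝ) := Submodule.span ℝ (Set.range X.row)
  have hE : Module.finrank ℝ E = k := by rw [← hrk, X.rank_eq_finrank_span_row]
  let a : Fin n → E := fun i => ⟨X.row i, Submodule.subset_span ⟨i, rfl⟩⟩
  have ha : Submodule.span ℝ (Set.range a) = ⊤ := by
    rw [← Submodule.span_span_coe_preimage (R := ℝ) (s := Set.range X.row)]
    congr 1
    ext x
    simp [a, Subtype.ext_iff]
  let ω : (Fin k → Fin m) → E [⋀^Fin k]→ₗ[ℝ] ℝ := fun g =>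
    Matrix.detRowAlternating.compLinearMap ((LinearMap.funLeft ℝ ℝ g).comp E.subtype)
  have hω : ∀ f g, ω g (a ∘ f) = (X.submatrix f g).det := fun f g => rfl
  have hφ : ∀ (u : Fin m → ℝ) (i : Fin n),
      ((Fintype.linearCombination ℝ u).comp E.subtype) (a i) = X.mulVec u i := fun u i => by
    simp [a, Fintype.linearCombination_apply, Matrix.mulVec, dotProduct]
  have hg : ∃ g : Fin k → Fin m, StrictMono g ∧ ω g ≠ 0 := by
    obtain ⟨g, hg, hinj⟩ := exists_strictMono_injOn_row_span hrk
    refine ⟨g, hg, fun h0 => ?_⟩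
    let b := Module.finBasisOfFinrankEq ℝ E hE
    have hli : LinearIndependent ℝ (((LinearMap.funLeft ℝ ℝ g).comp E.subtype) ∘ b) := by
      refine b.linearIndependent.map' _ (LinearMap.ker_eq_bot'.2 fun x hx => ?_)
      exact Subtype.ext (hinj x x.2 hx)
    refine alternatingMap_ne_zero_of_linearIndependent
      (ω := (Matrix.detRowAlternating : (Fin k → ℝ) [⋀^Fin k]→ₗ[ℝ] ℝ)) (by simp) (fun h1 => ?_) hli
      (congrArg (fun η => η b) h0)
    have : (1 : Matrix (Fin k) (Fin k) ℝ).det = 0 :=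
      congrArg (fun η => η (1 : Matrix (Fin k) (Fin k) ℝ)) h1
    simp at this
  constructor
  · intro h u
    by_contra! hu
    obtain ⟨c, e, he, hc⟩ := exists_alternating_of_le_variation (k := k) (by omega) (w := X.mulVec u)
    obtain ⟨g, hg, hg0⟩ := hg
    obtain ⟨f, hf, hne⟩ := exists_strictMono_alternatingMap_ne_zero hE hg0 ha
    have halt : ∀ j : Fin (k + 1), 0 < (-1 : ℝ) ^ (j : ℕ) *
        (c • (Fintype.linearCombination ℝ u).comp E.subtype) (a (e j)) := fun j => by
      rw [LinearMap.smul_apply, hφ]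
      exact hc j
    rcases h g hg with hnn | hnp
    · exact not_alternating_of_nonneg hE (ω g) a hnn ⟨f, hf, hne⟩ _ he halt
    · refine not_alternating_of_nonneg hE (-ω g) a (fun f hf => ?_) ⟨f, hf, ?_⟩ _ he halt
      · exact neg_nonneg.2 (hnp f hf)
      · exact neg_ne_zero.2 hne
  · intro h g _
    by_contra! hcon
    obtain ⟨⟨f₁, hf₁, h₁⟩, f₂, hf₂, h₂⟩ := hcon
    refine not_mul_neg_of_not_alternating hE (ω g) a (fun φ e he hφe => ?_) hf₁ hf₂
      (mul_neg_of_neg_of_pos h₁ h₂)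
    obtain ⟨Φ, hΦ⟩ := φ.exists_extend
    have hu : ∀ i, X.mulVec (fun l => Φ (Pi.single l 1)) i = φ (a i) := by
      intro i
      rw [← hΦ]
      have : X.row i = ∑ l, X i l • (Pi.single l (1 : ℝ) : Fin m → ℝ) := by
        rw [← pi_eq_sum_univ']
        rfl
      simp only [a, LinearMap.comp_apply, Submodule.subtype_apply]
      rw [this, map_sum]
      simp [Matrix.mulVec, dotProduct]
    have hle := le_variation_of_alternating (w := X.mulVec fun l => Φ (Pi.single l 1)) he
      fun j => by rw [hu]; exact hφe j
    have := h fun l => Φ (Pi.single l 1)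
    omega
end

section
/- Let X be a real n×m matrix such that all of its row-initial and column-initial minors of order j are strictly positive for every j ∈ {1,…,min{n,m}−1}, and all of its row-initial and column-initial minors of order min{n,m} are nonnegative. Then X is totally positive (all minors of all orders are nonnegative) and, moreover, every minor of X of order strictly less than min{n,m} is strictly positive. -/
open Matrix Polynomial Filter

namespace Matrix

/-- **Jacobi's identity** for a complementary block of the adjugate. -/
theorem det_mul_det_adjugate_toBlocks₁₁ {R p q : Type*} [CommRing R] [Fintype p] [DecidableEq p]
    [Fintype q] [DecidableEq q] (M : Matrix (p ⊕ q) (p ⊕ q) R) :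
    M.det * M.adjugate.toBlocks₁₁.det = M.det ^ Fintype.card p * M.toBlocks₂₂.det := by
  have h : M * fromBlocks M.adjugate.toBlocks₁₁ 0 M.adjugate.toBlocks₂₁ 1 =
      fromBlocks (M.det • 1) M.toBlocks₁₂ 0 M.toBlocks₂₂ := by
    have hM := M.mul_adjugate
    rw [← fromBlocks_toBlocks M.adjugate] at hM
    nth_rw 1 [← fromBlocks_toBlocks M] at hM
    rw [fromBlocks_multiply, ← fromBlocks_one, fromBlocks_smul, fromBlocks_inj] at hM
    nth_rw 1 [← fromBlocks_toBlocks M]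
    rw [fromBlocks_multiply, hM.1, hM.2.2.1]
    simp
  have hdet := congrArg det h
  rwa [det_mul, det_fromBlocks_zero₁₂, det_fromBlocks_zero₂₁, det_one, mul_one, det_smul, det_one,
    mul_one] at hdet

/-- The equivalence singling out the first and the last index of `Fin (k + 2)`. -/
noncomputable def finEndsEquiv (k : ℕ) : Fin 2 ⊕ Fin k ≃ Fin (k + 2) :=
  Equiv.ofBijective (Sum.elim ![0, Fin.last (k + 1)] fun i => i.castSucc.succ) <| by
    rw [Fintype.bijective_iff_injective_and_card]
    refine ⟨?_, by simp [add_comm]⟩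
    rintro (a | a) (b | b) h
    · fin_cases a <;> fin_cases b <;> simp_all [Fin.ext_iff]
    · fin_cases a
      · simp_all [Fin.ext_iff]
      · simp_all [Fin.ext_iff]; omega
    · fin_cases b
      · simp_all [Fin.ext_iff]
      · simp_all [Fin.ext_iff]; omega
    · simpa using h

/-- The **Desnanot–Jacobi identity**, multiplied by the determinant. -/
theorem det_mul_desnanot_jacobi {R : Type*} [CommRing R] {k : ℕ}
    (M : Matrix (Fin (k + 2)) (Fin (k + 2)) R) :
    M.det * (M.det * (M.submatrix (fun i : Fin k => i.castSucc.succ)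
      (fun i : Fin k => i.castSucc.succ)).det) =
    M.det * ((M.submatrix Fin.succ Fin.succ).det * (M.submatrix Fin.castSucc Fin.castSucc).det -
      (M.submatrix Fin.succ Fin.castSucc).det * (M.submatrix Fin.castSucc Fin.succ).det) := by
  have h := det_mul_det_adjugate_toBlocks₁₁ (M.submatrix (finEndsEquiv k) (finEndsEquiv k))
  have h22 : (M.submatrix (finEndsEquiv k) (finEndsEquiv k)).toBlocks₂₂ =
      M.submatrix (fun i : Fin k => i.castSucc.succ) (fun i : Fin k => i.castSucc.succ) := rfl
  rw [h22, adjugate_submatrix_equiv_self, det_submatrix_equiv_self, Fintype.card_fin] at h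
  have h0 : finEndsEquiv k (Sum.inl 0) = 0 := rfl
  have h1 : finEndsEquiv k (Sum.inl 1) = Fin.last (k + 1) := rfl
  simp only [det_fin_two, toBlocks₁₁, of_apply, submatrix_apply, h0, h1,
    adjugate_fin_succ_eq_det_submatrix, Fin.succAbove_last, Fin.val_zero, Fin.val_last, zero_add,
    add_zero, pow_zero, one_mul] at h
  have hs : (Fin.succAbove (0 : Fin (k + 2)) : Fin (k + 1) → Fin (k + 2)) = Fin.succ :=
    funext Fin.succAbove_zero_apply
  rw [hs, ← two_mul, pow_mul] at h
  have hsq : ((-1 : R) ^ (k + 1)) * (-1) ^ (k + 1) = 1 := by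
    rw [← mul_pow]; simp
  simp only [even_two, Even.neg_pow, one_pow, one_mul] at h
  linear_combination -h - M.det * (M.submatrix Fin.succ Fin.castSucc).det *
    (M.submatrix Fin.castSucc Fin.succ).det * hsq

/-- The **Desnanot–Jacobi identity** (Dodgson condensation). -/
theorem desnanot_jacobi {R : Type*} [CommRing R] {k : ℕ}
    (M : Matrix (Fin (k + 2)) (Fin (k + 2)) R) :
    M.det * (M.submatrix (fun i : Fin k => i.castSucc.succ)
      (fun i : Fin k => i.castSucc.succ)).det =
    (M.submatrix Fin.succ Fin.succ).det * (M.submatrix Fin.castSucc Fin.castSucc).det -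
      (M.submatrix Fin.succ Fin.castSucc).det * (M.submatrix Fin.castSucc Fin.succ).det := by
  have h := mul_left_cancel₀ (det_mvPolynomialX_ne_zero (Fin (k + 2)) ℤ)
    (det_mul_desnanot_jacobi (mvPolynomialX (Fin (k + 2)) (Fin (k + 2)) ℤ))
  have h' := congrArg (MvPolynomial.aeval fun p : Fin (k + 2) × Fin (k + 2) => M p.1 p.2) h
  simp only [map_mul, map_sub, AlgHom.map_det, AlgHom.mapMatrix_apply, ← submatrix_map] at h'
  have hM := mvPolynomialX_mapMatrix_aeval ℤ M
  rw [AlgHom.mapMatrix_apply] at hM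
  rwa [hM] at h'

theorem det_of_cons_single {R : Type*} [CommRing R] {k : ℕ} (A : Matrix (Fin k) (Fin (k + 1)) R)
    (q : Fin (k + 1)) :
    (of (vecCons (Pi.single q 1) A) : Matrix (Fin (k + 1)) (Fin (k + 1)) R).det =
      (-1) ^ (q : ℕ) * (A.submatrix id q.succAbove).det := by
  rw [det_succ_row_zero, Finset.sum_eq_single q]
  · have hq : (of (vecCons (Pi.single q 1) A) : Matrix (Fin (k + 1)) (Fin (k + 1)) R) 0 q = 1 :=
      Pi.single_eq_same q 1
    rw [hq, mul_one]
    rfl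
  · intro j _ hj
    simp [hj]
  · simp

/-- A three-term relation between the maximal minors of a `(k + 1) × (k + 2)` matrix and the
maximal minors of its first `k` rows. -/
theorem det_mul_det_interior {R : Type*} [CommRing R] {k : ℕ}
    (A : Matrix (Fin (k + 1)) (Fin (k + 2)) R) (i : Fin k) :
    (A.submatrix id i.castSucc.succ.succAbove).det *
      (A.submatrix Fin.castSucc (fun j : Fin k => j.castSucc.succ)).det =
    (A.submatrix Fin.castSucc (Fin.castSucc ∘ i.succ.succAbove)).det *
        (A.submatrix id Fin.succ).det +
      (A.submatrix Fin.castSucc (Fin.succ ∘ i.castSucc.succAbove)).det *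
        (A.submatrix id Fin.castSucc).det := by
  set q : Fin (k + 2) := i.castSucc.succ with hq
  set M : Matrix (Fin (k + 2)) (Fin (k + 2)) R := of (vecCons (Pi.single q 1) A) with hM
  have h := desnanot_jacobi M
  have hint : M.submatrix (fun j : Fin k => j.castSucc.succ) (fun j : Fin k => j.castSucc.succ) =
      A.submatrix Fin.castSucc (fun j : Fin k => j.castSucc.succ) := rfl
  have hss : M.submatrix Fin.succ Fin.succ = A.submatrix id Fin.succ := rfl
  have hsc : M.submatrix Fin.succ Fin.castSucc = A.submatrix id Fin.castSucc := rfl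
  have hcc : M.submatrix Fin.castSucc Fin.castSucc =
      of (vecCons (Pi.single i.succ 1) (A.submatrix Fin.castSucc Fin.castSucc)) := by
    ext a b
    refine Fin.cases ?_ (fun a => ?_) a
    · simp [hM, hq, Pi.single_apply, Fin.ext_iff]
    · rfl
  have hcs : M.submatrix Fin.castSucc Fin.succ =
      of (vecCons (Pi.single i.castSucc 1) (A.submatrix Fin.castSucc Fin.succ)) := by
    ext a b
    refine Fin.cases ?_ (fun a => ?_) a
    · simp [hM, hq, Pi.single_apply, Fin.ext_iff]
    · rfl
  rw [hint, hss, hsc, hcc, hcs, hM, det_of_cons_single, det_of_cons_single, det_of_cons_single,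
    submatrix_submatrix, submatrix_submatrix, Function.comp_id] at h
  have hsq : ((-1 : R) ^ (i : ℕ)) * (-1) ^ (i : ℕ) = 1 := by
    rw [← mul_pow]; simp
  simp only [hq, Fin.val_succ, Fin.val_castSucc, pow_succ] at h
  linear_combination (-(-1) ^ (i : ℕ)) * h + ((A.submatrix Fin.castSucc
    (Fin.castSucc ∘ i.succ.succAbove)).det * (A.submatrix id Fin.succ).det +
      (A.submatrix Fin.castSucc (Fin.succ ∘ i.castSucc.succAbove)).det *
        (A.submatrix id Fin.castSucc).det - (A.submatrix id i.castSucc.succ.succAbove).det *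
      (A.submatrix Fin.castSucc (fun j : Fin k => j.castSucc.succ)).det) * hsq

end Matrix

/-- `x` is nonnegative, and even positive when `s` holds. -/
def NonnegPosIf (s : Prop) (x : ℝ) : Prop := 0 ≤ x ∧ (s → 0 < x)

theorem NonnegPosIf.of_mul_eq {s : Prop} {a b c x y z : ℝ} (ha : 0 < a) (hb : 0 < b) (hc : 0 < c)
    (hx : NonnegPosIf s x) (hy : NonnegPosIf s y) (h : z * c = a * x + b * y) :
    NonnegPosIf s z := by
  have hx0 := hx.1
  have hy0 := hy.1
  refine ⟨nonneg_of_mul_nonneg_left (h ▸ by positivity) hc, fun hs => ?_⟩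
  have hx1 := hx.2 hs
  exact pos_of_mul_pos_left (h ▸ by positivity) hc.le

theorem exists_gap_of_strictMono {k m : ℕ} {g : Fin (k + 1) → Fin m} (hg : StrictMono g)
    (hgap : ¬ ∀ i, (g i : ℕ) = g 0 + (i : ℕ)) :
    ∃ (i : Fin k) (c : Fin m), g i.castSucc < c ∧ c < g i.succ := by
  by_contra! hno
  refine hgap fun i => ?_
  induction i using Fin.induction with
  | zero => simp
  | succ i ih =>
    have hlt : (g i.castSucc : ℕ) < g i.succ := hg i.castSucc_lt_succ
    have hle := hno i ⟨g i.castSucc + 1, by omega⟩ (Fin.lt_def.2 (by simp))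
    have hle' : (g i.succ : ℕ) ≤ g i.castSucc + 1 := hle
    have ih' : (g i.castSucc : ℕ) = g 0 + (i : ℕ) := ih
    rw [Fin.val_succ]
    omega

/-- **Fekete's criterion** for a fixed set of rows: minors with consecutive columns control all
minors. -/
theorem nonnegPosIf_det_of_consecutive_columns {n m k : ℕ} {s : Prop}
    (X : Matrix (Fin n) (Fin m) ℝ) (f : Fin (k + 1) → Fin n)
    (hpos : ∀ g : Fin k → Fin m, StrictMono g → 0 < (X.submatrix (f ∘ Fin.castSucc) g).det)
    (hcons : ∀ g : Fin (k + 1) → Fin m, (∀ i, (g i : ℕ) = g 0 + (i : ℕ)) →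
      NonnegPosIf s (X.submatrix f g).det)
    (g : Fin (k + 1) → Fin m) (hg : StrictMono g) :
    NonnegPosIf s (X.submatrix f g).det := by
  induction hd : (g (Fin.last k) : ℕ) - g 0 using Nat.strong_induction_on generalizing g with
  | _ d ih =>
  by_cases hgap : ∀ i, (g i : ℕ) = g 0 + (i : ℕ)
  · exact hcons g hgap
  obtain ⟨i, c, hc₁, hc₂⟩ := exists_gap_of_strictMono hg hgap
  set G : Fin (k + 2) → Fin m := Fin.insertNth i.castSucc.succ c g with hG
  have hGm : StrictMono G := Fin.strictMono_insertNth hg i c hc₁ hc₂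
  have hGg : G ∘ i.castSucc.succ.succAbove = g := by
    ext j; simp [hG]
  have hG0 : G 0 = g 0 := by
    rw [← hGg]; simp
  have hGl : G (Fin.last (k + 1)) = g (Fin.last k) := by
    rw [← hGg, Function.comp_apply, Fin.succAbove_ne_last_last (by simp [Fin.ext_iff]; omega)]
  have h0l : (G 0 : ℕ) < G (Fin.succ 0) := hGm (Fin.succ_pos 0)
  have hll : (G (Fin.last k).castSucc : ℕ) < G (Fin.last (k + 1)) := hGm (Fin.castSucc_lt_last _)
  have h1l : (G (Fin.succ 0) : ℕ) ≤ G (Fin.last (k + 1)) := hGm.monotone (Fin.le_last _)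
  have h0l' : (G (Fin.castSucc 0) : ℕ) ≤ G (Fin.last k).castSucc :=
    hGm.monotone (Fin.castSucc_le_castSucc_iff.2 (Fin.zero_le _))
  have hrel := Matrix.det_mul_det_interior (X.submatrix f G) i
  simp only [Matrix.submatrix_submatrix, hGg, Function.comp_id] at hrel
  refine NonnegPosIf.of_mul_eq ?_ ?_ ?_ (ih _ ?_ (G ∘ Fin.succ) ?_ rfl)
    (ih _ ?_ (G ∘ Fin.castSucc) ?_ rfl) hrel
  · exact hpos _ (hGm.comp ((Fin.strictMono_castSucc).comp (Fin.strictMono_succAbove _)))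
  · exact hpos _ (hGm.comp ((Fin.strictMono_succ).comp (Fin.strictMono_succAbove _)))
  · exact hpos _ (hGm.comp ((Fin.strictMono_succ).comp Fin.strictMono_castSucc))
  · change (G (Fin.last (k + 1)) : ℕ) - G (Fin.succ 0) < d
    rw [← hd, ← hG0, ← hGl]
    omega
  · exact hGm.comp Fin.strictMono_succ
  · simp only [Function.comp_apply, Fin.castSucc_zero] at h0l' ⊢
    rw [← hd, ← hG0, ← hGl]
    omega
  · exact hGm.comp Fin.strictMono_castSucc

/-- Total positivity of order `N` from minors with consecutive rows and consecutive columns. -/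
theorem nonnegPosIf_det_of_consecutive {n m N : ℕ} (X : Matrix (Fin n) (Fin m) ℝ)
    (hcons : ∀ j ≤ N, ∀ (s t : ℕ) (f : Fin j → Fin n) (g : Fin j → Fin m),
      (∀ i, (f i : ℕ) = s + (i : ℕ)) → (∀ i, (g i : ℕ) = t + (i : ℕ)) →
      NonnegPosIf (j < N) (X.submatrix f g).det)
    (j : ℕ) (hj : j ≤ N) (f : Fin j → Fin n) (g : Fin j → Fin m) (hf : StrictMono f)
    (hg : StrictMono g) : NonnegPosIf (j < N) (X.submatrix f g).det := by
  induction j with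
  | zero => simp [NonnegPosIf]
  | succ k ih =>
    have hk : k < N := hj
    rw [← Matrix.det_transpose, Matrix.transpose_submatrix]
    refine nonnegPosIf_det_of_consecutive_columns Xᵀ g (fun f' hf' => ?_) (fun f' hf' => ?_) f hf
    · rw [← Matrix.transpose_submatrix, Matrix.det_transpose]
      exact (ih hk.le f' _ hf' (hg.comp Fin.strictMono_castSucc)).2 hk
    · rw [← Matrix.transpose_submatrix, Matrix.det_transpose]
      refine nonnegPosIf_det_of_consecutive_columns X f' (fun g' hg' => ?_) (fun g' hg' => ?_) g hg
      · refine (ih hk.le _ g' (StrictMono.comp ?_ Fin.strictMono_castSucc) hg').2 hk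
        intro a b hab
        rw [Fin.lt_def] at hab ⊢
        rw [hf' a, hf' b]
        omega
      · exact hcons _ hj _ _ f' g' hf' hg'

/-- Initial minors control all minors with consecutive rows and consecutive columns. -/
theorem nonnegPosIf_det_of_initial {n m : ℕ} (X : Matrix (Fin n) (Fin m) ℝ)
    (hinit : ∀ j ≤ min n m, ∀ (s t : ℕ) (f : Fin j → Fin n) (g : Fin j → Fin m),
      s = 0 ∨ t = 0 → (∀ i, (f i : ℕ) = s + (i : ℕ)) → (∀ i, (g i : ℕ) = t + (i : ℕ)) →
      NonnegPosIf (j < min n m) (X.submatrix f g).det)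
    (j : ℕ) (hj : j ≤ min n m) (s t : ℕ) (f : Fin j → Fin n) (g : Fin j → Fin m)
    (hf : ∀ i, (f i : ℕ) = s + (i : ℕ)) (hg : ∀ i, (g i : ℕ) = t + (i : ℕ)) :
    NonnegPosIf (j < min n m) (X.submatrix f g).det := by
  induction s generalizing t j with
  | zero => exact hinit j hj _ _ f g (Or.inl rfl) hf hg
  | succ s ihs =>
  induction t generalizing j with
  | zero => exact hinit j hj _ _ f g (Or.inr rfl) hf hg
  | succ t iht =>
  induction j with
  | zero => simp [NonnegPosIf]
  | succ k ihk =>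
    have hfk := hf (Fin.last k)
    have hgk := hg (Fin.last k)
    have hfn := (f (Fin.last k)).isLt
    have hgm := (g (Fin.last k)).isLt
    rw [Fin.val_last] at hfk hgk
    have hkN : k + 1 < min n m := by omega
    let F : Fin (k + 2) → Fin n := fun i => ⟨s + i, by omega⟩
    let G : Fin (k + 2) → Fin m := fun i => ⟨t + i, by omega⟩
    have hFs : F ∘ Fin.succ = f := by
      ext i; simp [F, hf i]; omega
    have hGs : G ∘ Fin.succ = g := by
      ext i; simp [G, hg i]; omega
    have hrel := Matrix.desnanot_jacobi (X.submatrix F G)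
    simp only [Matrix.submatrix_submatrix, hFs, hGs] at hrel
    have hFG := (ihs (k + 2) hkN t F G (fun _ => rfl) (fun _ => rfl)).1
    have hint := (ihk (by omega) (f ∘ Fin.castSucc) (g ∘ Fin.castSucc)
      (fun i => by simp [hf]) (fun i => by simp [hg])).2 (by omega)
    have hcc := (ihs (k + 1) hj t (F ∘ Fin.castSucc) (G ∘ Fin.castSucc) (fun _ => rfl)
      (fun _ => rfl)).2 hkN
    have hcs := (ihs (k + 1) hj (t + 1) (F ∘ Fin.castSucc) g (fun _ => rfl) hg).2 hkN
    have hsc := (iht (k + 1) hj f (G ∘ Fin.castSucc) hf (fun _ => rfl)).2 hkN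
    have hFi : (F ∘ fun i : Fin k => i.castSucc.succ) = f ∘ Fin.castSucc := by
      rw [← hFs]; rfl
    have hGi : (G ∘ fun i : Fin k => i.castSucc.succ) = g ∘ Fin.castSucc := by
      rw [← hGs]; rfl
    rw [hFi, hGi] at hrel
    have hpos : 0 < (X.submatrix f g).det :=
      pos_of_mul_pos_left (b := (X.submatrix (F ∘ Fin.castSucc) (G ∘ Fin.castSucc)).det)
        (by nlinarith [mul_nonneg hFG hint.le, mul_pos hsc hcs]) hcc.le
    exact ⟨hpos.le, fun _ => hpos⟩

/-- if all row- and column-initial minors of order `< min n m` are positive and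
those of order `min n m` are nonnegative, then `X` is totally positive and all minors of
order `< min n m` are positive. -/
theorem stmt7 {n m : ℕ} (X : Matrix (Fin n) (Fin m) ℝ)
    (hstrict : ∀ j : ℕ, 1 ≤ j → j < min n m → ∀ t : ℕ, 1 ≤ t →
      (∀ (f : Fin j → Fin n) (g : Fin j → Fin m),
        (∀ i, (f i : ℕ) = t - 1 + (i : ℕ)) → (∀ i, (g i : ℕ) = (i : ℕ)) →
        0 < (X.submatrix f g).det) ∧
      (∀ (f : Fin j → Fin n) (g : Fin j → Fin m),
        (∀ i, (f i : ℕ) = (i : ℕ)) → (∀ i, (g i : ℕ) = t - 1 + (i : ℕ)) →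
        0 < (X.submatrix f g).det))
    (hweak : ∀ t : ℕ, 1 ≤ t →
      (∀ (f : Fin (min n m) → Fin n) (g : Fin (min n m) → Fin m),
        (∀ i, (f i : ℕ) = t - 1 + (i : ℕ)) → (∀ i, (g i : ℕ) = (i : ℕ)) →
        0 ≤ (X.submatrix f g).det) ∧
      (∀ (f : Fin (min n m) → Fin n) (g : Fin (min n m) → Fin m),
        (∀ i, (f i : ℕ) = (i : ℕ)) → (∀ i, (g i : ℕ) = t - 1 + (i : ℕ)) →
        0 ≤ (X.submatrix f g).det)) :
    (∀ (j : ℕ) (f : Fin j → Fin n) (g : Fin j → Fin m), StrictMono f → StrictMono g →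
        0 ≤ (X.submatrix f g).det) ∧
    (∀ j : ℕ, j < min n m → ∀ (f : Fin j → Fin n) (g : Fin j → Fin m),
        StrictMono f → StrictMono g → 0 < (X.submatrix f g).det) := by
  have hinit : ∀ j ≤ min n m, ∀ (s t : ℕ) (f : Fin j → Fin n) (g : Fin j → Fin m),
      s = 0 ∨ t = 0 → (∀ i, (f i : ℕ) = s + (i : ℕ)) → (∀ i, (g i : ℕ) = t + (i : ℕ)) →
      NonnegPosIf (j < min n m) (X.submatrix f g).det := by
    intro j hj s t f g hst hf hg
    obtain rfl | hj0 := Nat.eq_zero_or_pos j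
    · simp [NonnegPosIf]
    obtain hlt | rfl := hj.lt_or_eq
    · have hpos : 0 < (X.submatrix f g).det := by
        obtain rfl | rfl := hst
        · exact (hstrict j hj0 hlt (t + 1) (by omega)).2 f g (by simpa using hf) (by simpa using hg)
        · exact (hstrict j hj0 hlt (s + 1) (by omega)).1 f g (by simpa using hf) (by simpa using hg)
      exact ⟨hpos.le, fun _ => hpos⟩
    · refine ⟨?_, fun h => absurd h (lt_irrefl _)⟩
      obtain rfl | rfl := hst
      · exact (hweak (t + 1) (by omega)).2 f g (by simpa using hf) (by simpa using hg)
      · exact (hweak (s + 1) (by omega)).1 f g (by simpa using hf) (by simpa using hg)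
  have hall := nonnegPosIf_det_of_consecutive X (nonnegPosIf_det_of_initial X hinit)
  refine ⟨fun j f g hf hg => ?_, fun j hj f g hf hg => (hall j hj.le f g hf hg).2 hj⟩
  have hjn := Fintype.card_le_of_injective f hf.injective
  have hjm := Fintype.card_le_of_injective g hg.injective
  simp only [Fintype.card_fin] at hjn hjm
  exact (hall j (le_min hjn hjm) f g hf hg).1
end

section
/- Let X be a real n×m matrix with n > m and let k satisfy 2k ≤ m. Suppose there exists ε ∈ {−1,+1} such that ε·det(X_{α,β}) > 0 for all α = {1,…,k−r} ∪ {t,…,t+r−1} with r ∈ {1,…,k}, t ∈ {k−r+1,…,n−r+1} and all β = {1,…,k−r̄} ∪ {t̄,…,t̄+r̄−1} with r̄ ∈ {1,…,k}, t̄ ∈ {k−r̄+1,…,m−r̄+1}, except that in the cases where simultaneously α = {t,…,t+k−1} with t ∈ {k+1,…,n−k+1} and β = {t̄,…,t̄+k−1} with t̄ ∈ {k+1,…,m−k+1}, the nonstrict inequality ε·det(X_{α,β}) ≥ 0 suffices. Then X is k-sign consistent. -/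
open Matrix Polynomial Filter

/-- The value of an alternating map at the vectors indexed by `S`, listed in increasing order. -/
noncomputable def sortedEval {V : Type*} [AddCommGroup V] [Module ℝ V] {k : ℕ}
    (D : V [⋀^Fin k]→ₗ[ℝ] ℝ) (v : ℕ → V) (S : Finset ℕ) : ℝ :=
  if h : S.card = k then D (v ∘ S.orderEmbOfFin h) else 0

section SortedEval

variable {V : Type*} [AddCommGroup V] [Module ℝ V]

lemma sortedEval_of_strictMono {k : ℕ} (D : V [⋀^Fin k]→ₗ[ℝ] ℝ) (v : ℕ → V) {S : Finset ℕ}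
    {f : Fin k → ℕ} (hf : StrictMono f) (hfS : ∀ i, f i ∈ S) (hS : S.card = k) :
    sortedEval D v S = D (v ∘ f) := by
  rw [sortedEval, dif_pos hS, ← Finset.orderEmbOfFin_unique hS hfS hf]

lemma lt_card_filter_iff_orderEmbOfFin_lt {k : ℕ} {S : Finset ℕ} (hS : S.card = k) (x : ℕ)
    (j : Fin k) : (j : ℕ) < (S.filter (· < x)).card ↔ S.orderEmbOfFin hS j < x := by
  set g := S.orderEmbOfFin hS
  have hcard : (S.filter (· < x)).card = (Finset.univ.filter fun i => g i < x).card := by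
    rw [← Finset.card_map g.toEmbedding]
    congr 1
    ext y
    simp only [Finset.mem_filter, Finset.mem_map, Finset.mem_univ, true_and]
    constructor
    · rintro ⟨hy, hyx⟩
      obtain ⟨i, rfl⟩ : y ∈ Set.range g := by simpa [g] using hy
      exact ⟨i, hyx, rfl⟩
    · rintro ⟨i, hi, rfl⟩
      exact ⟨S.orderEmbOfFin_mem hS i, hi⟩
  rw [hcard]
  constructor
  · intro h
    by_contra hj
    have : (Finset.univ.filter fun i => g i < x) ⊆ Finset.Iio j := by
      intro i hi
      simp only [Finset.mem_filter, Finset.mem_univ, true_and, Finset.mem_Iio] at hi ⊢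
      exact g.lt_iff_lt.1 (hi.trans_le (not_lt.1 hj))
    have := Finset.card_le_card this
    rw [Fin.card_Iio] at this
    omega
  · intro h
    have : Finset.Iic j ⊆ Finset.univ.filter fun i => g i < x := by
      intro i hi
      simp only [Finset.mem_filter, Finset.mem_univ, true_and, Finset.mem_Iic] at hi ⊢
      exact (g.monotone hi).trans_lt h
    have := Finset.card_le_card this
    rw [Fin.card_Iic] at this
    omega

lemma sortedEval_insert {k : ℕ} (D : V [⋀^Fin (k + 1)]→ₗ[ℝ] ℝ) (v : ℕ → V) {S : Finset ℕ}
    (hS : S.card = k) {x : ℕ} (hx : x ∉ S) :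
    sortedEval D v (insert x S) =
      (-1) ^ (S.filter (· < x)).card * sortedEval (D.curryLeft (v x)) v S := by
  set g := S.orderEmbOfFin hS
  let q : Fin (k + 1) := ⟨(S.filter (· < x)).card,
    Nat.lt_succ_of_le ((Finset.card_filter_le _ _).trans hS.le)⟩
  have hq (j : Fin k) : (j : ℕ) < q ↔ g j < x := lt_card_filter_iff_orderEmbOfFin_lt hS x j
  have hgS (j : Fin k) : g j ∈ S := S.orderEmbOfFin_mem hS j
  have hmono : StrictMono (q.insertNth (α := fun _ => ℕ) x g) := by
    refine (Fin.strictMono_insertNth_iff q x g).2 ⟨g.strictMono, fun i hi => (hq i).1 hi,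
      fun i hi => lt_of_le_of_ne ?_ fun h => hx (h ▸ hgS i)⟩
    exact not_lt.1 fun h => absurd ((hq i).2 h) (not_lt.2 hi)
  rw [sortedEval_of_strictMono D v hmono ?_ (by rw [Finset.card_insert_of_notMem hx, hS]),
    sortedEval, dif_pos hS, AlternatingMap.curryLeft_apply_apply]
  · have : v ∘ q.insertNth (α := fun _ => ℕ) x g =
        q.insertNth (α := fun _ => V) (v x) (v ∘ g) := by
      ext i
      induction i using q.succAboveCases with
      | x => simp
      | p j => simp
    rw [this, AlternatingMap.map_insertNth]
    simp [q, g]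
  · intro i
    induction i using q.succAboveCases with
    | x => simp
    | p j => simpa using Or.inr (hgS j)

lemma sortedEval_insert_insert {k : ℕ} (D : V [⋀^Fin (k + 2)]→ₗ[ℝ] ℝ) (v : ℕ → V)
    {S : Finset ℕ} (hS : S.card = k) {x y : ℕ} (hxy : x < y) (hx : x ∉ S) (hy : y ∉ S) :
    sortedEval D v (insert x (insert y S)) =
      (-1) ^ (S.filter (· < x)).card * (-1) ^ (S.filter (· < y)).card *
        D (Matrix.vecCons (v x) (Matrix.vecCons (v y) (v ∘ S.orderEmbOfFin hS))) := by
  rw [sortedEval_insert (k := k + 1) D v (by rw [Finset.card_insert_of_notMem hy, hS])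
      (by simp [hx, hxy.ne]), sortedEval_insert _ v hS hy, Finset.filter_insert,
    if_neg (by omega), sortedEval, dif_pos hS, mul_assoc]
  rfl

/-- The three-term Plücker relation, for a top-degree alternating map. -/
lemma AlternatingMap.three_term_relation {k : ℕ} (hV : Module.finrank ℝ V = k + 2)
    (D : V [⋀^Fin (k + 2)]→ₗ[ℝ] ℝ) (s : Fin k → V) (a b c d : V)
    (hab : D (vecCons a (vecCons b s)) ≠ 0) :
    D (vecCons a (vecCons c s)) * D (vecCons b (vecCons d s)) =
      D (vecCons a (vecCons b s)) * D (vecCons c (vecCons d s)) +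
      D (vecCons a (vecCons d s)) * D (vecCons b (vecCons c s)) := by
  have hli : LinearIndependent ℝ (vecCons a (vecCons b s)) := by
    by_contra h
    exact hab (D.map_linearDependent _ h)
  have hspan := hli.span_eq_top_of_card_eq_finrank (by simp [hV])
  let ω (x y : V) : ℝ := (D.curryLeft x).curryLeft y s
  have hadd (x y z : V) : ω x (y + z) = ω x y + ω x z := by simp [ω, -AlternatingMap.curryLeft_apply_apply]
  have hadd' (x y z : V) : ω (x + y) z = ω x z + ω y z := by simp [ω, -AlternatingMap.curryLeft_apply_apply]
  have hsmul (x y : V) (r : ℝ) : ω x (r • y) = r * ω x y := by simp [ω, -AlternatingMap.curryLeft_apply_apply]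
  have hself (x : V) : ω x x = 0 := by simp [ω, -AlternatingMap.curryLeft_apply_apply]
  have hswap (x y : V) : ω y x = - ω x y := by
    have := hself (x + y)
    rw [hadd, hadd', hadd', hself, hself] at this
    linarith
  have hs (x : V) (i : Fin k) : ω x (s i) = 0 :=
    D.map_eq_zero_of_eq _ (i := 1) (j := i.succ.succ) (by simp)
      (by intro h; simp [Fin.ext_iff] at h)
  have hsum (x : V) (w : Fin k → ℝ) : ω x (∑ i, w i • s i) = 0 := by
    have : ω x (∑ i, w i • s i) = ∑ i, w i * ω x (s i) := by
      let L : V →ₗ[ℝ] ℝ := { toFun := ω x, map_add' := hadd x, map_smul' := fun r y => hsmul x y r }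
      exact (map_sum L (fun i => w i • s i) Finset.univ).trans
        (Finset.sum_congr rfl fun i _ => hsmul _ _ _)
    simp [this, hs]
  have hdecomp (x : V) : ∃ (p q : ℝ) (w : Fin k → ℝ), x = p • a + (q • b + ∑ i, w i • s i) := by
    obtain ⟨w, rfl⟩ := (Submodule.mem_span_range_iff_exists_fun ℝ).1
      (hspan ▸ Submodule.mem_top : x ∈ Submodule.span ℝ (Set.range _))
    exact ⟨w 0, w 1, fun i => w i.succ.succ, by simp [Fin.sum_univ_succ]⟩
  obtain ⟨p, q, w, hc⟩ := hdecomp c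
  obtain ⟨p', q', w', hd⟩ := hdecomp d
  have key (x : V) : ω x c = p * ω x a + q * ω x b := by
    rw [hc, hadd, hadd, hsmul, hsmul, hsum]; ring
  have key' (x : V) : ω x d = p' * ω x a + q' * ω x b := by
    rw [hd, hadd, hadd, hsmul, hsmul, hsum]; ring
  change ω a c * ω b d = ω a b * ω c d + ω a d * ω b c
  rw [key' c, hswap a c, hswap b c, key a, key b, key' a, key' b, hself, hself, hswap a b]
  ring

lemma sortedEval_three_term_relation {k : ℕ} (hV : Module.finrank ℝ V = k)
    (D : V [⋀^Fin k]→ₗ[ℝ] ℝ) (v : ℕ → V) {S : Finset ℕ} (hS : S.card + 2 = k) {a b c d : ℕ}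
    (hab : a < b) (hbc : b < c) (hcd : c < d) (ha : a ∉ S) (hb : b ∉ S) (hc : c ∉ S)
    (hd : d ∉ S) (h : sortedEval D v (insert a (insert b S)) ≠ 0) :
    sortedEval D v (insert a (insert c S)) * sortedEval D v (insert b (insert d S)) =
      sortedEval D v (insert a (insert b S)) * sortedEval D v (insert c (insert d S)) +
      sortedEval D v (insert a (insert d S)) * sortedEval D v (insert b (insert c S)) := by
  subst hS
  rw [sortedEval_insert_insert D v rfl hab ha hb] at h ⊢
  rw [sortedEval_insert_insert D v rfl (hab.trans hbc) ha hc,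
    sortedEval_insert_insert D v rfl (hbc.trans hcd) hb hd,
    sortedEval_insert_insert D v rfl hcd hc hd,
    sortedEval_insert_insert D v rfl (hab.trans (hbc.trans hcd)) ha hd,
    sortedEval_insert_insert D v rfl hbc hb hc]
  have := AlternatingMap.three_term_relation hV D (v ∘ S.orderEmbOfFin rfl) (v a) (v b) (v c)
    (v d) (right_ne_zero_of_mul h)
  linear_combination ((-1) ^ (S.filter (· < a)).card * (-1) ^ (S.filter (· < b)).card *
    (-1) ^ (S.filter (· < c)).card * (-1) ^ (S.filter (· < d)).card) * this

end SortedEval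

/-- A set function satisfying the three-term relations that is positive on the sets containing
`{0, …, s}` and lies in the cone `C` on the sets `{0, …, s - 1} ∪ {t, …, t + k - s - 1}` lies in
`C` on all sets containing `{0, …, s - 1}`. -/
lemma mem_cone_of_range_subset {p : Finset ℕ → ℝ} {n k s : ℕ} {C : ConvexCone ℝ ℝ}
    (hC : ∀ x, 0 < x → x ∈ C)
    (hp : ∀ (S : Finset ℕ) (a b c d : ℕ), S.card + 2 = k → a < b → b < c → c < d →
      a ∉ S → b ∉ S → c ∉ S → d ∉ S → p (insert a (insert b S)) ≠ 0 →
      p (insert a (insert c S)) * p (insert b (insert d S)) =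
        p (insert a (insert b S)) * p (insert c (insert d S)) +
        p (insert a (insert d S)) * p (insert b (insert c S)))
    (hs : s < k)
    (hpos : ∀ α ⊆ Finset.range n, α.card = k → Finset.range (s + 1) ⊆ α → 0 < p α)
    (hst : ∀ t, s ≤ t → t + (k - s) ≤ n →
      p (Finset.range s ∪ Finset.Ico t (t + (k - s))) ∈ C)
    {α : Finset ℕ} (hαn : α ⊆ Finset.range n) (hα : α.card = k) (hsα : Finset.range s ⊆ α) :
    p α ∈ C := by
  suffices H : ∀ (w b : ℕ) (α : Finset ℕ), α ⊆ Finset.range n → α.card = k →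
      Finset.range s ⊆ α → s ≤ b → α ⊆ Finset.range s ∪ Finset.Ico b (b + w) → p α ∈ C by
    refine H n s α hαn hα hsα le_rfl fun x hx => ?_
    have := hαn hx
    simp only [Finset.mem_union, Finset.mem_range, Finset.mem_Ico] at *
    omega
  intro w
  induction w with
  | zero =>
    intro b α _ hα _ _ h
    have := Finset.card_le_card h
    simp at this
    omega
  | succ w ih =>
    intro b α hαn hα hsα hsb h
    by_cases hsm : s ∈ α
    · refine hC _ (hpos α hαn hα ?_)
      rw [Finset.range_add_one]
      exact Finset.insert_subset hsm hsα
    by_cases hb : b ∈ α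
    swap
    · refine ih (b + 1) α hαn hα hsα (by omega) fun x hx => ?_
      have h1 := h hx
      have : x ≠ b := fun e => hb (e ▸ hx)
      simp only [Finset.mem_union, Finset.mem_range, Finset.mem_Ico] at *
      omega
    by_cases hd : b + w ∈ α
    swap
    · refine ih b α hαn hα hsα hsb fun x hx => ?_
      have h1 := h hx
      have : x ≠ b + w := fun e => hd (e ▸ hx)
      simp only [Finset.mem_union, Finset.mem_range, Finset.mem_Ico] at *
      omega
    by_cases hj : Finset.Ico b (b + (w + 1)) ⊆ α
    · have e : α = Finset.range s ∪ Finset.Ico b (b + (w + 1)) :=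
        h.antisymm (Finset.union_subset hsα hj)
      have hw : w + 1 = k - s := by
        rw [e, Finset.card_union_of_disjoint] at hα
        · simp at hα
          omega
        · rw [Finset.disjoint_left]
          intro x hx hx'
          simp only [Finset.mem_range, Finset.mem_Ico] at *
          omega
      rw [e, hw]
      have := Finset.mem_range.1 (hαn hd)
      exact hst b hsb (by omega)
    obtain ⟨j, hjI, hjα⟩ := Finset.not_subset.1 hj
    rw [Finset.mem_Ico] at hjI
    have hjb : j ≠ b := fun e => hjα (e ▸ hb)
    have hjd : j ≠ b + w := fun e => hjα (e ▸ hd)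
    have hsb' : s < b := lt_of_le_of_ne hsb fun e => hsm (e ▸ hb)
    set S := (α.erase (b + w)).erase b with hSdef
    have hbS : b ∉ S := by simp [S]
    have hdS : b + w ∉ S := by simp [S]
    have hsS : s ∉ S := by simp [S, hsm]
    have hjS : j ∉ S := by simp [S, hjα]
    have hSα : insert b (insert (b + w) S) = α := by
      ext x
      simp only [S, Finset.mem_insert, Finset.mem_erase]
      by_cases h1 : x = b
      · simp [h1, hb]
      · by_cases h2 : x = b + w
        · simp [h2, hd]
        · simp [h1, h2]
    have hScard : S.card + 2 = k := by
      rw [← hα, ← hSα, Finset.card_insert_of_notMem, Finset.card_insert_of_notMem hdS]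
      simp only [Finset.mem_insert, not_or]
      exact ⟨by omega, hbS⟩
    have hrS : Finset.range s ⊆ S := fun x hx => by
      have := hsα hx
      simp only [S, Finset.mem_erase, Finset.mem_range] at *
      exact ⟨by omega, by omega, this⟩
    have hSn : S ⊆ Finset.range n := ((Finset.erase_subset _ _).trans
      (Finset.erase_subset _ _)).trans hαn
    have hdn := Finset.mem_range.1 (hαn hd)
    have hsub {x y : ℕ} (hx : x < n) (hy : y < n) : insert x (insert y S) ⊆ Finset.range n := by
      simp [Finset.insert_subset_iff, hx, hy, hSn]
    have hcard {x y : ℕ} (hxy : x ≠ y) (hx : x ∉ S) (hy : y ∉ S) :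
        (insert x (insert y S)).card = k := by
      rw [Finset.card_insert_of_notMem (by simp [hxy, hx]), Finset.card_insert_of_notMem hy, hScard]
    have hPos {y : ℕ} (hsy : s < y) (hyn : y < n) (hy : y ∉ S) :
        0 < p (insert s (insert y S)) := by
      refine hpos _ (hsub (by omega) hyn) (hcard hsy.ne hsS hy) ?_
      rw [Finset.range_add_one]
      exact Finset.insert_subset_insert _ (hrS.trans (Finset.subset_insert _ _))
    have hrange {x y : ℕ} : Finset.range s ⊆ insert x (insert y S) :=
      (hrS.trans (Finset.subset_insert _ _)).trans (Finset.subset_insert _ _)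
    have hSmem {x : ℕ} (hx : x ∈ S) : x < s ∨ b < x ∧ x < b + w := by
      simp only [S, Finset.mem_erase] at hx
      have := h hx.2.2
      simp only [Finset.mem_union, Finset.mem_range, Finset.mem_Ico] at this
      omega
    have h1 : p (insert j (insert (b + w) S)) ∈ C := by
      refine ih (b + 1) _ (hsub (by omega) hdn) (hcard hjd hjS hdS) hrange (by omega)
        fun x hx => ?_
      simp only [Finset.mem_insert, Finset.mem_union, Finset.mem_range, Finset.mem_Ico] at *
      rcases hx with rfl | rfl | hx
      · omega
      · omega
      · have := hSmem hx
        omega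
    have h2 : p (insert b (insert j S)) ∈ C := by
      refine ih b _ (hsub (by omega) (by omega)) (hcard hjb.symm hbS hjS) hrange (by omega)
        fun x hx => ?_
      simp only [Finset.mem_insert, Finset.mem_union, Finset.mem_range, Finset.mem_Ico] at *
      rcases hx with rfl | rfl | hx
      · omega
      · omega
      · have := hSmem hx
        omega
    have hsj := hPos (y := j) (by omega) (by omega) hjS
    have hsbp := hPos hsb' (by omega) hbS
    have hsd := hPos (y := b + w) (by omega) hdn hdS
    have hrel := hp S s b j (b + w) hScard hsb' (by omega) (by omega) hsS hbS hjS hdS hsbp.ne'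
    have hmem := C.add_mem (C.smul_mem hsbp h1) (C.smul_mem hsd h2)
    rw [smul_eq_mul, smul_eq_mul, ← hrel, hSα] at hmem
    simpa [hsj.ne'] using C.smul_mem (inv_pos.2 hsj) hmem

/-- A set function satisfying the three-term relations that is positive on `{0, …, k - 1}` and on
the staircase sets containing `0`, and lies in `C` on the intervals of length `k`, lies in `C` on
all `k`-element sets. -/
lemma mem_cone_of_staircase_sets {p : Finset ℕ → ℝ} {n k : ℕ} {C : ConvexCone ℝ ℝ}
    (hC : ∀ x, 0 < x → x ∈ C)
    (hp : ∀ (S : Finset ℕ) (a b c d : ℕ), S.card + 2 = k → a < b → b < c → c < d →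
      a ∉ S → b ∉ S → c ∉ S → d ∉ S → p (insert a (insert b S)) ≠ 0 →
      p (insert a (insert c S)) * p (insert b (insert d S)) =
        p (insert a (insert b S)) * p (insert c (insert d S)) +
        p (insert a (insert d S)) * p (insert b (insert c S)))
    (hk : 0 < k) (hbase : 0 < p (Finset.range k))
    (hpos : ∀ s t, 0 < s → s < k → s ≤ t → t + (k - s) ≤ n →
      0 < p (Finset.range s ∪ Finset.Ico t (t + (k - s))))
    (hcons : ∀ t, t + k ≤ n → p (Finset.Ico t (t + k)) ∈ C)
    {α : Finset ℕ} (hαn : α ⊆ Finset.range n) (hα : α.card = k) : p α ∈ C := by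
  have H : ∀ s ≤ k, 0 < s → ∀ α ⊆ Finset.range n, α.card = k → Finset.range s ⊆ α → 0 < p α := by
    intro s hs
    induction hs using Nat.decreasingInduction with
    | self =>
      intro _ α _ hα hsub
      rwa [← Finset.eq_of_subset_of_card_le hsub (by simp [hα])]
    | @of_succ s hs ih =>
      intro h0 α hαn hα hsα
      exact mem_cone_of_range_subset (C := ConvexCone.strictlyPositive ℝ ℝ) (fun x hx => hx) hp hs
        (ih s.succ_pos) (fun t hst htn => hpos s t h0 hs hst htn) hαn hα hsα
  exact mem_cone_of_range_subset hC hp hk (H 1 hk one_pos)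
    (fun t _ htn => by simpa using hcons t htn) hαn hα (by simp)

/-- `f` enumerates `{0, …, s - 1} ∪ {t, …, t + k - s - 1}`. -/
def IsStaircase {n k : ℕ} (s t : ℕ) (f : Fin k → Fin n) : Prop :=
  s < k ∧ s ≤ t ∧ ∀ i, (f i : ℕ) = if (i : ℕ) < s then (i : ℕ) else t + (i - s)

lemma mem_cone_of_isStaircase {n k : ℕ} (A : Matrix (Fin n) (Fin k) ℝ) (ε : ℝ)
    {C : ConvexCone ℝ ℝ} (hC : ∀ x, 0 < x → x ∈ C) (hk : 0 < k)
    (hpos : ∀ (s t : ℕ) (f : Fin k → Fin n), IsStaircase s t f → 0 < s ∨ t = 0 →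
      0 < ε * (A.submatrix f id).det)
    (hcons : ∀ (t : ℕ) (f : Fin k → Fin n), IsStaircase 0 t f →
      ε * (A.submatrix f id).det ∈ C)
    {f : Fin k → Fin n} (hf : StrictMono f) : ε * (A.submatrix f id).det ∈ C := by
  let v : ℕ → Fin k → ℝ := fun i => if h : i < n then A ⟨i, h⟩ else 0
  let D : (Fin k → ℝ) [⋀^Fin k]→ₗ[ℝ] ℝ := ε • Matrix.detRowAlternating
  have hD (f : Fin k → Fin n) (hf : StrictMono f) {S : Finset ℕ} (hfS : ∀ i, (f i : ℕ) ∈ S)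
      (hS : S.card = k) : sortedEval D v S = ε * (A.submatrix f id).det := by
    rw [sortedEval_of_strictMono D v (f := fun i => (f i : ℕ)) hf hfS hS]
    have : v ∘ (fun i => (f i : ℕ)) = A.submatrix f id := by
      ext i j
      simp [v]
    rw [this]
    rfl
  have hkn : k ≤ n := by simpa using Fintype.card_le_of_injective f hf.injective
  have hst (s t : ℕ) (hs : s < k) (hst : s ≤ t) (htn : t + (k - s) ≤ n) :
      ∃ f : Fin k → Fin n, IsStaircase s t f ∧
        sortedEval D v (Finset.range s ∪ Finset.Ico t (t + (k - s))) =
          ε * (A.submatrix f id).det := by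
    let f : Fin k → Fin n := fun i =>
      ⟨if (i : ℕ) < s then (i : ℕ) else t + (i - s), by split_ifs <;> omega⟩
    refine ⟨f, ⟨hs, hst, fun i => rfl⟩, hD f ?_ ?_ ?_⟩
    · intro i j hij
      simp only [f, Fin.lt_def] at hij ⊢
      split_ifs <;> omega
    · intro i
      simp only [f, Finset.mem_union, Finset.mem_range, Finset.mem_Ico]
      split_ifs <;> omega
    · rw [Finset.card_union_of_disjoint]
      · simp
        omega
      · rw [Finset.disjoint_left]
        intro x hx hx'
        simp only [Finset.mem_range, Finset.mem_Ico] at *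
        omega
  have hcard : (Finset.univ.image fun i => (f i : ℕ)).card = k := by
    rw [Finset.card_image_of_injective _ fun i j h => hf.injective (Fin.val_injective h)]
    simp
  rw [← hD f hf (S := Finset.univ.image fun i => (f i : ℕ)) (by simp) hcard]
  refine mem_cone_of_staircase_sets (n := n) hC (fun S a b c d hS hab hbc hcd ha hb hc hd h =>
    sortedEval_three_term_relation (by simp) D v hS hab hbc hcd ha hb hc hd h) hk ?_ ?_ ?_ ?_ hcard
  · obtain ⟨f, hf, e⟩ := hst 0 0 hk le_rfl (by omega)
    rw [← Nat.Ico_zero_eq_range]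
    simp only [Finset.range_zero, Finset.empty_union, Nat.sub_zero, Nat.zero_add] at e
    exact e ▸ hpos 0 0 f hf (Or.inr rfl)
  · intro s t hs0 hs h1 h2
    obtain ⟨f, hf, e⟩ := hst s t hs h1 h2
    exact e ▸ hpos s t f hf (Or.inl hs0)
  · intro t ht
    obtain ⟨f, hf, e⟩ := hst 0 t hk (Nat.zero_le _) (by simpa using ht)
    simp only [Finset.range_zero, Finset.empty_union, Nat.sub_zero] at e
    exact e ▸ hcons t f hf
  · intro x hx
    obtain ⟨i, -, rfl⟩ := Finset.mem_image.1 hx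
    simp

/-- for `n > m`, `2k ≤ m`, strict one-signedness of the staircase minors
(non-strict for the fully consecutive row and column sets) implies `k`-sign consistency. -/
theorem stmt9 {n m : ℕ} (X : Matrix (Fin n) (Fin m) ℝ) (k : ℕ)
    (hnm : m < n) (hkm : 2 * k ≤ m)
    (hcond : ∃ ε : ℝ, (ε = 1 ∨ ε = -1) ∧
      ∀ r ∈ Finset.Icc 1 k, ∀ t ∈ Finset.Icc (k - r + 1) (n - r + 1),
      ∀ rb ∈ Finset.Icc 1 k, ∀ tb ∈ Finset.Icc (k - rb + 1) (m - rb + 1),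
      ∀ (f : Fin k → Fin n) (g : Fin k → Fin m),
        (∀ i, (f i : ℕ) =
          if (i : ℕ) < k - r then (i : ℕ) else (i : ℕ) + t - 1 - (k - r)) →
        (∀ i, (g i : ℕ) =
          if (i : ℕ) < k - rb then (i : ℕ) else (i : ℕ) + tb - 1 - (k - rb)) →
        (if r = k ∧ k + 1 ≤ t ∧ rb = k ∧ k + 1 ≤ tb
          then 0 ≤ ε * (X.submatrix f g).det
          else 0 < ε * (X.submatrix f g).det)) :
    SC X k := by
  rcases Nat.eq_zero_or_pos k with rfl | hk
  · exact Or.inl fun f g _ _ => by simp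
  obtain ⟨ε, hε, hcond⟩ := hcond
  suffices H : ∀ (f : Fin k → Fin n) (g : Fin k → Fin m), StrictMono f → StrictMono g →
      0 ≤ ε * (X.submatrix f g).det by
    rcases hε with rfl | rfl
    · exact Or.inl fun f g hf hg => by simpa using H f g hf hg
    · exact Or.inr fun f g hf hg => by simpa using H f g hf hg
  have hboth (s t sb tb : ℕ) (f : Fin k → Fin n) (g : Fin k → Fin m) (hf : IsStaircase s t f)
      (hg : IsStaircase sb tb g) :
      0 ≤ ε * (X.submatrix f g).det ∧
        ((0 < s ∨ t = 0) ∨ (0 < sb ∨ tb = 0) → 0 < ε * (X.submatrix f g).det) := by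
    obtain ⟨hs, hst, hf⟩ := hf
    obtain ⟨hsb, hstb, hg⟩ := hg
    have hfl := hf ⟨k - 1, by omega⟩
    have hgl := hg ⟨k - 1, by omega⟩
    have hfn := (f ⟨k - 1, by omega⟩).isLt
    have hgn := (g ⟨k - 1, by omega⟩).isLt
    rw [if_neg (by simp only; omega)] at hfl hgl
    simp only at hfl hgl
    have key := hcond (k - s) (by rw [Finset.mem_Icc]; omega) (t + 1)
      (by rw [Finset.mem_Icc]; omega) (k - sb) (by rw [Finset.mem_Icc]; omega) (tb + 1)
      (by rw [Finset.mem_Icc]; omega) f g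
      (fun i => by rw [hf i]; split_ifs <;> omega) (fun i => by rw [hg i]; split_ifs <;> omega)
    split_ifs at key with h
    · exact ⟨key, fun h' => by omega⟩
    · exact ⟨key.le, fun _ => key⟩
  have htr (f : Fin k → Fin n) (g : Fin k → Fin m) :
      ((X.submatrix f id)ᵀ.submatrix g id).det = (X.submatrix f g).det := by
    rw [← Matrix.det_transpose]
    rfl
  have hC : ∀ x : ℝ, 0 < x → x ∈ ConvexCone.positive ℝ ℝ := fun x hx => hx.le
  have hrow (s t : ℕ) (f : Fin k → Fin n) (hf : IsStaircase s t f) (g : Fin k → Fin m)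
      (hg : StrictMono g) : 0 ≤ ε * (X.submatrix f g).det := by
    rw [← htr]
    refine mem_cone_of_isStaircase (X.submatrix f id)ᵀ ε hC hk ?_ ?_ hg
    · intro sb tb g hg h
      rw [htr]
      exact (hboth s t sb tb f g hf hg).2 (Or.inr h)
    · intro tb g hg
      rw [htr]
      exact (hboth s t 0 tb f g hf hg).1
  have hrow' (s t : ℕ) (f : Fin k → Fin n) (hf : IsStaircase s t f) (hst : 0 < s ∨ t = 0)
      (g : Fin k → Fin m) (hg : StrictMono g) : 0 < ε * (X.submatrix f g).det := by
    rw [← htr]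
    refine mem_cone_of_isStaircase (C := ConvexCone.strictlyPositive ℝ ℝ)
      (X.submatrix f id)ᵀ ε (fun x hx => hx) hk ?_ ?_ hg
    · intro sb tb g hg _
      rw [htr]
      exact (hboth s t sb tb f g hf hg).2 (Or.inl hst)
    · intro tb g hg
      rw [htr]
      exact (hboth s t 0 tb f g hf hg).2 (Or.inl hst)
  intro f g hf hg
  exact mem_cone_of_isStaircase (X.submatrix id g) ε hC hk
    (fun s t f hf hst => hrow' s t f hf hst g hg) (fun t f hf => hrow 0 t f hf g hg) hf
end
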